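/- For each fixed ε with 0 < 2πε < 1 and each fixed σ > 0, the random rotation number depends smoothly on τ: there is a C^∞ function r : ℝ → ℝ such that for every τ ∈ ℝ, for P-almost every ω and every x ∈ ℝ, lim_{n→∞} (G^n_{τ,ω}(x) − x)/n = r(τ). -/

import Mathlib

open MeasureTheory Real Filter Set Function

noncomputable section

/-- The lift `G_{τ,w}(x) = x + τ + σ w − ε sin (2πx)` of the noisy Arnol'd circle map. -/
def Gmap (τ ε σ w : ℝ) (x : ℝ) : ℝ :=
  x + τ + σ * w - ε * Real.sin (2 * π * x)

/-- Iterated lifts `G^n_{τ,ω} = G_{τ,ω_{n−1}} ∘ ⋯ ∘ G_{τ,ω_0}`. -/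
def Gn (τ ε σ : ℝ) (ω : ℤ → ℝ) : ℕ → ℝ → ℝ
  | 0 => id
  | n + 1 => Gmap τ ε σ (ω n) ∘ Gn τ ε σ ω n

/-- The uniform probability measure on `I = [−1/2, 1/2]`. -/
def nuI : Measure ℝ := volume.restrict (Icc (-(1/2) : ℝ) (1/2))

/-- `P` is the two-sided infinite product measure `ν^⊗ℤ` on `Ω = I^ℤ`, characterized by
its finite-dimensional marginals. -/
def IsProductNuZ (P : Measure (ℤ → ℝ)) : Prop :=
  IsProbabilityMeasure P ∧
    ∀ s : Finset ℤ, P.map (fun ω (i : s) => ω i) = Measure.pi (fun _ : s => nuI)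

open Topology

/-- complexified map -/
def Tc (τ ε : ℝ) (z : ℂ) : ℂ := z + τ - ε * Complex.sin (2 * π * z)

lemma Tc_hasStrict (τ ε : ℝ) (z : ℂ) :
    HasStrictDerivAt (Tc τ ε) (1 - 2 * π * ε * Complex.cos (2 * π * z)) z := by
  have h1 : HasStrictDerivAt (fun z : ℂ => 2 * (π : ℂ) * z) (2 * π) z := by
    simpa using (hasStrictDerivAt_id z).const_mul (2 * (π : ℂ))
  have h2 := ((hasStrictDerivAt_id z).add_const (τ : ℂ)).sub
    ((h1.csin).const_mul (ε : ℂ))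
  convert! h2 using 1
  ring

def Tc' (ε : ℝ) (z : ℂ) : ℂ := 1 - 2 * π * ε * Complex.cos (2 * π * z)

lemma Tc_hasDeriv (τ ε : ℝ) (z : ℂ) : HasDerivAt (Tc τ ε) (Tc' ε z) z :=
  (Tc_hasStrict τ ε z).hasDerivAt

lemma Tc_cont (τ ε : ℝ) : Continuous (Tc τ ε) := by
  unfold Tc; fun_prop

lemma two_pi_mul_re (z : ℂ) : (2 * (π:ℂ) * z).re = 2 * π * z.re := by simp
lemma two_pi_mul_im (z : ℂ) : (2 * (π:ℂ) * z).im = 2 * π * z.im := by simp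

lemma csin_re (z : ℂ) : (Complex.sin z).re = Real.sin z.re * Real.cosh z.im := by
  rw [Complex.sin_eq z, ← Complex.ofReal_sin, ← Complex.ofReal_cos, ← Complex.ofReal_sinh,
    ← Complex.ofReal_cosh]
  simp only [Complex.add_re, Complex.mul_re, Complex.ofReal_re, Complex.ofReal_im, Complex.I_re,
    Complex.I_im, Complex.mul_im]; ring
lemma csin_im (z : ℂ) : (Complex.sin z).im = Real.cos z.re * Real.sinh z.im := by
  rw [Complex.sin_eq z, ← Complex.ofReal_sin, ← Complex.ofReal_cos, ← Complex.ofReal_sinh,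
    ← Complex.ofReal_cosh]
  simp only [Complex.add_im, Complex.mul_re, Complex.ofReal_re, Complex.ofReal_im, Complex.I_re,
    Complex.I_im, Complex.mul_im]; ring

lemma abs_sinh_le_norm_csin (z : ℂ) : |Real.sinh z.im| ≤ ‖Complex.sin z‖ := by
  apply abs_le_of_sq_le_sq _ (norm_nonneg _)
  rw [Complex.sq_norm, Complex.normSq_apply, csin_re, csin_im]
  have := Real.cosh_sq z.im
  have h2 := Real.sin_sq_add_cos_sq z.re
  nlinarith [sq_nonneg (Real.sin z.re), sq_nonneg (Real.sinh z.im)]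

lemma Tc_re_int (τ ε : ℝ) (z : ℂ) (n : ℤ) (h : z.re = n) : (Tc τ ε z).re = n + τ := by
  have : Real.sin (2 * π * n) = 0 := by
    rw [mul_comm, ← mul_assoc]
    exact_mod_cast Real.sin_int_mul_pi (n * 2)
  simp only [Tc, Complex.sub_re, Complex.add_re, Complex.ofReal_re, Complex.re_ofReal_mul,
    csin_re, two_pi_mul_re, h, this]
  ring

/-- boundedness of the lifted paths -/
lemma Tc_bdd (τ ε : ℝ) (hε : 0 < ε) (M : ℝ) (z0 : ℂ) : ∃ R : ℝ, ∀ (t : ℝ) (_ : 0 ≤ t) (Γ : ℝ → ℂ),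
    ContinuousOn Γ (Icc 0 t) → Γ 0 = z0 → (∀ u ∈ Icc 0 t, ‖Tc τ ε (Γ u)‖ ≤ M) →
    ‖Γ t‖ ≤ R := by
  obtain ⟨N, hN⟩ := exists_nat_gt (|M| + |τ| + |z0.re|)
  have key : ∀ X : ℝ, ∃ Y : ℝ, ∀ z : ℂ, |z.re| ≤ X → ‖Tc τ ε z‖ ≤ M → |z.im| ≤ Y := by
    intro X
    refine ⟨(|M + X + (|τ|)| + 1) / ε + 1, fun z hz hT => ?_⟩
    by_contra hcon
    push Not at hcon
    have h1 : ‖(ε:ℂ) * Complex.sin (2 * π * z)‖ ≤ ‖Tc τ ε z‖ + ‖z‖ + |τ| := by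
      have : (ε:ℂ) * Complex.sin (2 * π * z) = z + τ - Tc τ ε z := by simp [Tc]
      rw [this]
      have := norm_sub_le (z + τ) (Tc τ ε z)
      have h3 := norm_add_le z (τ:ℂ)
      rw [Complex.norm_real, Real.norm_eq_abs] at h3
      linarith
    rw [norm_mul, Complex.norm_real, Real.norm_eq_abs, abs_of_pos hε] at h1
    have h2 := abs_sinh_le_norm_csin (2 * π * z)
    rw [two_pi_mul_im] at h2
    have h3 : ‖z‖ ≤ |z.re| + |z.im| := Complex.norm_le_abs_re_add_abs_im z
    have h4 : ∀ u : ℝ, 0 ≤ u → u ^ 2 / 4 ≤ Real.sinh u := by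
      intro u hu
      rw [Real.sinh_eq]
      have a := Real.quadratic_le_exp_of_nonneg hu
      have b : Real.exp (-u) ≤ 1 := Real.exp_le_one_iff.2 (by linarith)
      nlinarith
    have h5 : |z.im| ^ 2 ≤ |Real.sinh (2 * π * z.im)| := by
      rw [Real.abs_sinh]
      refine le_trans ?_ (h4 _ (abs_nonneg _))
      rw [abs_mul, abs_of_pos Real.two_pi_pos]
      have : 1 ≤ π ^ 2 := by nlinarith [Real.pi_gt_three]
      nlinarith [sq_nonneg |z.im|]
    set y := |z.im|
    set C := |M + X + (|τ|)|
    have hC : M + X + |τ| ≤ C := le_abs_self _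
    have hC0 : 0 ≤ C := abs_nonneg _
    have hy1 : 1 ≤ y := by
      have : 0 ≤ (C + 1) / ε := by positivity
      linarith
    have h6 : C + 1 < ε * y := by
      have : (C + 1) / ε < y := by linarith
      rw [div_lt_iff₀ hε] at this
      linarith
    have h7 : ε * y ^ 2 ≤ C + y := by
      have : ε * y ^ 2 ≤ ε * ‖Complex.sin (2 * π * z)‖ := by gcongr; linarith
      linarith
    nlinarith
  obtain ⟨Y, hY⟩ := key N
  refine ⟨N + Y, fun t ht Γ hc h0 hT => ?_⟩
  have hre : |(Γ t).re| ≤ N := by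
    by_contra hcon
    push Not at hcon
    have hcr : ContinuousOn (fun u => (Γ u).re) (Icc 0 t) :=
      Complex.continuous_re.comp_continuousOn hc
    have hbad : ∀ n : ℤ, |(n:ℝ)| = N → ∀ u ∈ Icc 0 t, (Γ u).re ≠ n := by
      intro n hn u hu he
      have h1 := Tc_re_int τ ε (Γ u) n he
      have h2 := (Complex.abs_re_le_norm (Tc τ ε (Γ u))).trans (hT u hu)
      rw [h1] at h2
      have h3 := abs_sub_abs_le_abs_sub (n:ℝ) (-τ)
      rw [abs_neg, sub_neg_eq_add, hn] at h3
      have := le_abs_self M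
      have := abs_nonneg z0.re
      linarith
    have hz0 : |(Γ 0).re| < N := by
      rw [h0]
      have := abs_nonneg M
      have := abs_nonneg τ
      linarith
    rw [abs_lt] at hz0
    rcases lt_abs.1 hcon with h | h
    · obtain ⟨u, hu, he⟩ := intermediate_value_Icc ht hcr ⟨hz0.2.le, h.le⟩
      exact hbad N (by simp) u hu (by simpa using he)
    · obtain ⟨u, hu, he⟩ := intermediate_value_Icc' ht hcr
        (show (-(N:ℝ)) ∈ Icc _ _ from ⟨by linarith, hz0.1.le⟩)
      exact hbad (-N) (by simp) u hu (by simpa using he)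
  have him := hY (Γ t) hre (hT t ⟨ht, le_rfl⟩)
  exact (Complex.norm_le_abs_re_add_abs_im _).trans (by linarith)

lemma path_lift (τ ε : ℝ) (hε : 0 < ε) (γ : ℝ → ℂ) (hγ : Continuous γ)
    (hcrit : ∀ t ∈ Icc (0:ℝ) 1, ∀ z, Tc τ ε z = γ t → Tc' ε z ≠ 0) (z0 : ℂ)
    (h0 : Tc τ ε z0 = γ 0) :
    ∃ Γ : ℝ → ℂ, ContinuousOn Γ (Icc 0 1) ∧ Γ 0 = z0 ∧ ∀ t ∈ Icc (0:ℝ) 1, Tc τ ε (Γ t) = γ t := by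
  let S : Set ℝ := {t | t ∈ Icc (0:ℝ) 1 ∧ ∃ Γ : ℝ → ℂ, ContinuousOn Γ (Icc 0 t) ∧ Γ 0 = z0 ∧
    ∀ u ∈ Icc (0:ℝ) t, Tc τ ε (Γ u) = γ u}
  have hS0 : (0:ℝ) ∈ S := by
    refine ⟨⟨le_rfl, zero_le_one⟩, fun _ => z0, continuousOn_const, rfl, fun u hu => ?_⟩
    have : u = 0 := by simpa using hu
    rw [this, h0]
  have hSb : BddAbove S := ⟨1, fun t ht => ht.1.2⟩
  obtain ⟨M, hM⟩ := (isCompact_Icc (a := (0:ℝ)) (b := 1)).exists_bound_of_continuousOn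
    hγ.continuousOn
  obtain ⟨R, hR⟩ := Tc_bdd τ ε hε M z0
  set s := sSup S with hs
  have hs0 : 0 ≤ s := le_csSup hSb hS0
  have hs1 : s ≤ 1 := csSup_le ⟨0, hS0⟩ fun t ht => ht.1.2
  obtain ⟨t, -, htl, htS⟩ := exists_seq_tendsto_sSup ⟨0, hS0⟩ hSb
  choose ht01 G hGc hG0 hGT using htS
  have hGR : ∀ n, G n (t n) ∈ Metric.closedBall (0:ℂ) R := by
    intro n
    rw [mem_closedBall_zero_iff]
    refine hR (t n) (ht01 n).1 (G n) (hGc n) (hG0 n) fun u hu => ?_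
    rw [hGT n u hu]
    exact hM u ⟨hu.1, hu.2.trans (ht01 n).2⟩
  obtain ⟨z, -, φ, hφ, hz⟩ := (isCompact_closedBall (0:ℂ) R).tendsto_subseq hGR
  have htl' := htl.comp hφ.tendsto_atTop
  have hTz : Tc τ ε z = γ s := by
    have h1 := ((Tc_cont τ ε).tendsto z).comp hz
    have h2 := (hγ.tendsto s).comp htl'
    refine tendsto_nhds_unique h1 (h2.congr fun n => ?_)
    simp only [Function.comp]
    rw [hGT (φ n) (t (φ n)) ⟨(ht01 _).1, le_rfl⟩]
  have hne := hcrit s ⟨hs0, hs1⟩ z hTz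
  have hst : HasStrictFDerivAt (Tc τ ε)
    ((ContinuousLinearEquiv.unitsEquivAut ℂ (Units.mk0 _ hne) : ℂ ≃L[ℂ] ℂ) : ℂ →L[ℂ] ℂ) z :=
    (Tc_hasStrict τ ε z).hasStrictFDerivAt_equiv hne
  let e := hst.toOpenPartialHomeomorph (Tc τ ε)
  have hez : z ∈ e.source := hst.mem_toOpenPartialHomeomorph_source
  have hec : ∀ w, e w = Tc τ ε w := fun w => rfl
  have hsrc : ∀ᶠ n in atTop, G (φ n) (t (φ n)) ∈ e.source := hz (e.open_source.mem_nhds hez)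
  have htgt : γ ⁻¹' e.target ∈ 𝓝 s := by
    refine hγ.continuousAt (e.open_target.mem_nhds ?_)
    rw [← hTz]; exact e.map_source hez
  obtain ⟨δ, hδ, hball⟩ := Metric.mem_nhds_iff.1 htgt
  have hclose : ∀ᶠ n in atTop, t (φ n) ∈ Metric.ball s δ := htl' (Metric.ball_mem_nhds s hδ)
  obtain ⟨n, hn1, hn2⟩ := (hsrc.and hclose).exists
  set v := t (φ n)
  -- extension
  have hext : ∀ u, v ≤ u → u ∈ Metric.ball s δ → u ≤ 1 → u ∈ S := by
    intro u hvu hus hu1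
    refine ⟨⟨(ht01 _).1.trans hvu, hu1⟩, fun x => if x ≤ v then G (φ n) x else e.symm (γ x),
      ?_, ?_, ?_⟩
    · refine ContinuousOn.if' ?_ ?_ ?_ ?_
      · intro a ha
        have hav : a = v := by
          have := ha.2
          rw [show {x : ℝ | x ≤ v} = Iic v from rfl, frontier_Iic] at this
          exact this
        rw [if_pos hav.le, hav]
        refine Filter.Tendsto.mono_left (hGc (φ n) v ⟨(ht01 _).1, le_rfl⟩) ?_
        exact nhdsWithin_mono _ fun x hx => ⟨hx.1.1, hx.2⟩
      · intro a ha
        have hav : a = v := by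
          have := ha.2
          rw [show {x : ℝ | x ≤ v} = Iic v from rfl, frontier_Iic] at this
          exact this
        rw [if_pos hav.le, hav]
        have h1 : e.symm (γ v) = G (φ n) v := by
          rw [← hGT (φ n) v ⟨(ht01 _).1, le_rfl⟩, ← hec, e.left_inv hn1]
        have h2 : ContinuousAt (fun x => e.symm (γ x)) v :=
          ContinuousAt.comp (e.continuousAt_symm (hball hn2)) hγ.continuousAt
        have h3 : Tendsto (fun x => e.symm (γ x)) (𝓝 v) (𝓝 (G (φ n) v)) := by
          rw [← h1]; exact h2
        exact h3.mono_left nhdsWithin_le_nhds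
      · exact (hGc (φ n)).mono fun x hx => ⟨hx.1.1, hx.2⟩
      · intro x hx
        have hx2 : v < x := not_le.1 hx.2
        have hxb : x ∈ Metric.ball s δ := by
          rw [Metric.mem_ball, Real.dist_eq, abs_lt] at hn2 hus ⊢
          constructor
          · linarith
          · linarith [hx.1.2]
        exact (ContinuousAt.comp (e.continuousAt_symm (hball hxb))
          hγ.continuousAt).continuousWithinAt
    · change (if (0:ℝ) ≤ v then G (φ n) 0 else e.symm (γ 0)) = z0
      rw [if_pos (ht01 (φ n)).1, hG0]
    · intro x hx
      by_cases hxv : x ≤ v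
      · simp only [if_pos hxv]
        exact hGT (φ n) x ⟨hx.1, hxv⟩
      · simp only [if_neg hxv]
        have hxb : x ∈ Metric.ball s δ := by
          rw [Metric.mem_ball, Real.dist_eq, abs_lt] at hn2 hus ⊢
          push Not at hxv
          constructor
          · linarith
          · linarith [hx.2]
        rw [← hec, e.right_inv (hball hxb)]
  have hvs : v ≤ s := le_csSup hSb ⟨ht01 _, G (φ n), hGc _, hG0 _, hGT _⟩
  have hs_eq : s = 1 := by
    by_contra hne1
    have hlt : s < 1 := lt_of_le_of_ne hs1 hne1
    have hm : min 1 (s + δ / 2) ∈ S := by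
      have hsl : s < min 1 (s + δ / 2) := lt_min hlt (by linarith)
      refine hext _ (hvs.trans hsl.le) ?_ (min_le_left _ _)
      rw [Metric.mem_ball, Real.dist_eq, abs_lt]
      have := min_le_right 1 (s + δ / 2)
      constructor <;> linarith
    have := le_csSup hSb hm
    have hsl : s < min 1 (s + δ / 2) := lt_min hlt (by linarith)
    linarith
  have h1S : (1:ℝ) ∈ S := hext 1 (by rw [← hs_eq]; exact hvs)
    (by rw [← hs_eq]; exact Metric.mem_ball_self hδ) le_rfl
  exact h1S.2

lemma Tc_lift (τ ε : ℝ) (hε : 0 < ε) (α : ℂ) (r : ℝ) (hr : 0 < r) (g : ℂ → ℂ)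
    (hg : DifferentiableOn ℂ g (Metric.ball α r))
    (hcrit : ∀ w ∈ Metric.ball α r, ∀ z, Tc τ ε z = g w → Tc' ε z ≠ 0) (z0 : ℂ)
    (h0 : Tc τ ε z0 = g α) :
    ∃ G : ℂ → ℂ, DifferentiableOn ℂ G (Metric.ball α r) ∧ G α = z0 ∧
      ∀ w ∈ Metric.ball α r, Tc τ ε (G w) = g w := by
  classical
  let D := Metric.ball α r
  have hαD : α ∈ D := Metric.mem_ball_self hr
  let E := {z : ℂ // Tc' ε z ≠ 0}
  let p : E → ℂ := fun z => Tc τ ε z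
  have hTc'c : Continuous (Tc' ε) := by unfold Tc'; fun_prop
  have hEo : IsOpen {z : ℂ | Tc' ε z ≠ 0} := isOpen_ne_fun hTc'c continuous_const
  have hloc1 : IsLocalHomeomorphOn (Tc τ ε) {z : ℂ | Tc' ε z ≠ 0} := by
    refine IsLocalHomeomorphOn.mk _ _ fun z hz => ?_
    have hst : HasStrictFDerivAt (Tc τ ε)
      ((ContinuousLinearEquiv.unitsEquivAut ℂ (Units.mk0 _ hz) : ℂ ≃L[ℂ] ℂ) : ℂ →L[ℂ] ℂ) z :=
      (Tc_hasStrict τ ε z).hasStrictFDerivAt_equiv hz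
    exact ⟨hst.toOpenPartialHomeomorph (Tc τ ε), hst.mem_toOpenPartialHomeomorph_source,
      fun w _ => rfl⟩
  have hloc : IsLocalHomeomorph p := by
    rw [isLocalHomeomorph_iff_isLocalHomeomorphOn_univ]
    exact hloc1.comp (hEo.isOpenEmbedding_subtypeVal.isLocalHomeomorph.isLocalHomeomorphOn)
      (fun x _ => x.2)
  have hsep : IsSeparatedMap p := T2Space.isSeparatedMap p
  have hray : ∀ (t : ℝ), t ∈ Icc (0:ℝ) 1 → ∀ a ∈ D, α + t * (a - α) ∈ D := by
    intro t ht a ha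
    have := (convex_ball α r).add_smul_sub_mem hαD ha ht
    rwa [Complex.real_smul] at this
  -- path lifts
  have hpl : ∀ a : D, ∃ Γ : unitInterval → E, Continuous Γ ∧ (Γ 0 : ℂ) = z0 ∧
      (∀ t, Tc τ ε (Γ t) = g (α + ((t:ℝ):ℂ) * ((a:ℂ) - α))) ∧ ((a:ℂ) = α → (Γ 1 : ℂ) = z0) := by
    intro a
    by_cases ha : (a:ℂ) = α
    · refine ⟨fun _ => ⟨z0, hcrit α hαD z0 h0⟩, continuous_const, rfl, fun t => ?_, fun _ => rfl⟩
      simp [ha, h0]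
    · let γ : ℝ → ℂ := fun t => g (α + ((projIcc (0:ℝ) 1 zero_le_one t : ℝ) : ℂ) * ((a:ℂ) - α))
      have hγ : Continuous γ := by
        refine hg.continuousOn.comp_continuous ?_ ?_
        · have : Continuous fun t : ℝ => ((projIcc (0:ℝ) 1 zero_le_one t : ℝ) : ℂ) :=
            Complex.continuous_ofReal.comp (continuous_subtype_val.comp continuous_projIcc)
          fun_prop
        · intro t
          exact hray _ (projIcc (0:ℝ) 1 zero_le_one t).2 a a.2
      obtain ⟨Γ, hΓc, hΓ0, hΓT⟩ := path_lift τ ε hε γ hγ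
        (fun t _ z hz => hcrit _ (hray _ (projIcc (0:ℝ) 1 zero_le_one t).2 a a.2) z hz) z0
        (by simp [γ, h0])
      have hT : ∀ t : unitInterval, Tc τ ε (Γ t) = g (α + ((t:ℝ):ℂ) * ((a:ℂ) - α)) := by
        intro t
        rw [hΓT t t.2]
        simp only [γ]
        rw [projIcc_of_mem zero_le_one t.2]
      refine ⟨fun t => ⟨Γ t, hcrit _ (hray t t.2 a a.2) _ (hT t)⟩, ?_, ?_, hT, fun h => absurd h ha⟩
      · exact Continuous.subtype_mk (continuousOn_iff_continuous_domRestrict.1 hΓc) _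
      · simpa using hΓ0
  choose Γ hΓc hΓ0 hΓT hΓα using hpl
  let f : C(unitInterval × D, ℂ) :=
    ⟨fun q => g (α + ((q.1:ℝ):ℂ) * ((q.2:ℂ) - α)), by
      refine hg.continuousOn.comp_continuous (by fun_prop) ?_
      intro q
      exact hray q.1 q.1.2 q.2 q.2.2⟩
  have hcont : Continuous (fun q : unitInterval × D => Γ q.2 q.1) := by
    refine hloc.continuous_lift hsep f ?_ ?_ ?_
    · ext q
      exact hΓT q.2 q.1
    · have : (fun a : D => Γ a 0) = fun _ => ⟨z0, hcrit α hαD z0 h0⟩ := by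
        ext a; exact hΓ0 a
      simp only [this]
      exact continuous_const
    · exact fun a => hΓc a
  let G : ℂ → ℂ := fun w => if h : w ∈ D then (Γ ⟨w, h⟩ 1 : ℂ) else 0
  have hGT : ∀ w ∈ D, Tc τ ε (G w) = g w := by
    intro w hw
    simp only [G, dif_pos hw, hΓT]
    simp
  have hGc : ContinuousOn G D := by
    rw [continuousOn_iff_continuous_domRestrict]
    have : D.domRestrict G = fun a : D => (Γ a 1 : ℂ) := by
      ext a; simp [G, Set.domRestrict]
    rw [this]
    exact continuous_subtype_val.comp (hcont.comp (by fun_prop : Continuous fun a : D => ((1 : unitInterval), a)))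
  refine ⟨G, ?_, ?_, hGT⟩
  · intro w hw
    have hwn : D ∈ 𝓝 w := Metric.isOpen_ball.mem_nhds hw
    have hne := hcrit w hw (G w) (hGT w hw)
    have hst := Tc_hasStrict τ ε (G w)
    have h1 := hst.eventually_left_inverse hne
    have h2 := (hGc.continuousAt hwn).eventually h1
    have h3 : G =ᶠ[𝓝 w] fun w' => hst.localInverse (Tc τ ε) _ (G w) hne (g w') := by
      filter_upwards [h2, hwn] with w' hw' hw'D
      rw [← hGT w' hw'D]
      exact hw'.symm
    have h4 : DifferentiableAt ℂ (hst.localInverse (Tc τ ε) _ (G w) hne) (g w) := by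
      rw [← hGT w hw]
      exact (hst.to_localInverse hne).hasDerivAt.differentiableAt
    have h5 : DifferentiableAt ℂ g w := hg.differentiableAt hwn
    exact ((h4.comp w h5).congr_of_eventuallyEq h3).differentiableWithinAt
  · simp only [G, dif_pos hαD]
    exact hΓα ⟨α, hαD⟩ rfl

/-- iterated lift through a backward invariant critical point free set -/
lemma Tc_lift_iter (τ ε : ℝ) (hε : 0 < ε) (α : ℂ) (r : ℝ) (hr : 0 < r) (Bas : Set ℂ)
    (hback : ∀ z, Tc τ ε z ∈ Bas → z ∈ Bas) (hcrit : ∀ z ∈ Bas, Tc' ε z ≠ 0) (n : ℕ) :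
    ∀ (g : ℂ → ℂ) (_ : DifferentiableOn ℂ g (Metric.ball α r))
    (_ : ∀ w ∈ Metric.ball α r, g w ∈ Bas) (z0 : ℂ)
    (_ : (Tc τ ε)^[n] z0 = g α),
    ∃ G : ℂ → ℂ, DifferentiableOn ℂ G (Metric.ball α r) ∧ G α = z0 ∧
      (∀ w ∈ Metric.ball α r, G w ∈ Bas) ∧
      ∀ w ∈ Metric.ball α r, (Tc τ ε)^[n] (G w) = g w := by
  induction n with
  | zero => intro g hg hB z0 h0; exact ⟨g, hg, h0.symm, hB, fun w _ => rfl⟩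
  | succ n ih =>
    intro g hg hB z0 h0
    rw [Function.iterate_succ_apply] at h0
    obtain ⟨G, hG1, hG2, hG3, hG4⟩ := ih g hg hB (Tc τ ε z0) h0
    obtain ⟨G', h1, h2, h3⟩ := Tc_lift τ ε hε α r hr G hG1
      (fun w hw z hz => hcrit z (hback z (hz ▸ hG3 w hw))) z0 hG2.symm
    refine ⟨G', h1, h2, fun w hw => hback _ (by rw [h3 w hw]; exact hG3 w hw), fun w hw => ?_⟩
    rw [Function.iterate_succ_apply, h3 w hw, hG4 w hw]

lemma Tc_add_int (τ ε : ℝ) (z : ℂ) (m : ℤ) : Tc τ ε (z + m) = Tc τ ε z + m := by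
  have : Complex.sin (2 * π * (z + m)) = Complex.sin (2 * π * z) := by
    rw [show 2 * (π:ℂ) * (z + m) = 2 * π * z + m * (2 * π) by ring]
    exact Complex.sin_add_int_mul_two_pi _ _
  simp only [Tc, this]; ring

lemma Tc_iter_add_int (τ ε : ℝ) (n : ℕ) (z : ℂ) (m : ℤ) :
    (Tc τ ε)^[n] (z + m) = (Tc τ ε)^[n] z + m := by
  induction n generalizing z with
  | zero => rfl
  | succ n ih => rw [iterate_succ_apply, iterate_succ_apply, Tc_add_int, ih]

lemma Tc_conj (τ ε : ℝ) (z : ℂ) : Tc τ ε ((starRingEnd ℂ) z) = (starRingEnd ℂ) (Tc τ ε z) := by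
  have h2 : (starRingEnd ℂ) (2:ℂ) = 2 := Complex.conj_ofNat 2
  simp [Tc, ← Complex.sin_conj, h2]

lemma Tc_iter_conj (τ ε : ℝ) (n : ℕ) (z : ℂ) :
    (Tc τ ε)^[n] ((starRingEnd ℂ) z) = (starRingEnd ℂ) ((Tc τ ε)^[n] z) := by
  induction n generalizing z with
  | zero => rfl
  | succ n ih => rw [iterate_succ_apply, iterate_succ_apply, Tc_conj, ih]

def Bas (τ ε : ℝ) (α : ℂ) (r : ℝ) : Set ℂ :=
  {z | ∃ (n : ℕ) (m : ℤ), (Tc τ ε)^[n] z + m ∈ Metric.ball α r}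

lemma Bas_back (τ ε : ℝ) (α : ℂ) (r : ℝ) (z : ℂ) (h : Tc τ ε z ∈ Bas τ ε α r) :
    z ∈ Bas τ ε α r := by
  obtain ⟨n, m, h⟩ := h
  exact ⟨n + 1, m, h⟩

lemma Bas_add (τ ε : ℝ) (α : ℂ) (r : ℝ) (z : ℂ) (k : ℤ) (h : z ∈ Bas τ ε α r) :
    z + k ∈ Bas τ ε α r := by
  obtain ⟨n, m, h⟩ := h
  refine ⟨n, m - k, ?_⟩
  rw [Tc_iter_add_int]
  push_cast
  convert! h using 1
  ring

lemma Bas_conj (τ ε : ℝ) (α : ℝ) (r : ℝ) (z : ℂ) (h : z ∈ Bas τ ε α r) :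
    (starRingEnd ℂ) z ∈ Bas τ ε α r := by
  obtain ⟨n, m, h⟩ := h
  refine ⟨n, m, ?_⟩
  rw [Tc_iter_conj]
  rw [Metric.mem_ball, Complex.dist_eq] at h ⊢
  rw [← Complex.norm_conj] at h
  simpa using h

lemma contr_disc (f : ℂ → ℂ) (α lam : ℂ) (h0 : f α = α) (hf : HasDerivAt f lam α)
    (hl : ‖lam‖ < 1) : ∃ r > 0, ∀ z ∈ Metric.ball α r, Tendsto (fun n => f^[n] z) atTop (𝓝 α) := by
  obtain ⟨κ, hκ1, hκ2⟩ := exists_between hl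
  have hκ0 : 0 ≤ κ := (norm_nonneg _).trans hκ1.le
  have h1 : ∀ᶠ z in 𝓝 α, ‖f z - α‖ ≤ κ * ‖z - α‖ := by
    have := (hasDerivAt_iff_isLittleO.1 hf).bound (show 0 < κ - ‖lam‖ by linarith)
    filter_upwards [this] with z hz
    rw [h0] at hz
    have h2 : f z - α = (f z - α - (z - α) • lam) + (z - α) • lam := by ring
    rw [h2]
    refine (norm_add_le _ _).trans ?_
    rw [norm_smul]
    linarith
  obtain ⟨r, hr, hball⟩ := Metric.eventually_nhds_iff_ball.1 h1
  refine ⟨r, hr, fun z hz => ?_⟩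
  have h3 : ∀ n, f^[n] z ∈ Metric.ball α r ∧ ‖f^[n] z - α‖ ≤ κ ^ n * ‖z - α‖ := by
    intro n
    induction n with
    | zero => exact ⟨hz, by simp⟩
    | succ n ih =>
      rw [iterate_succ_apply']
      have h4 := hball _ ih.1
      have h5 : ‖f (f^[n] z) - α‖ ≤ κ ^ (n + 1) * ‖z - α‖ := by
        refine h4.trans ?_
        rw [pow_succ']
        nlinarith [ih.2]
      refine ⟨?_, h5⟩
      rw [Metric.mem_ball, Complex.dist_eq] at hz ⊢
      have : κ ^ (n + 1) ≤ 1 := pow_le_one₀ hκ0 hκ2.le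
      have := norm_nonneg (z - α)
      nlinarith
  rw [tendsto_iff_norm_sub_tendsto_zero]
  refine squeeze_zero (fun _ => norm_nonneg _) (fun n => (h3 n).2) ?_
  simpa using (tendsto_pow_atTop_nhds_zero_of_lt_one hκ0 hκ2).mul_const ‖z - α‖

lemma Tc_iter_sub (τ ε : ℝ) (q : ℕ) (p : ℤ) (n : ℕ) (z : ℂ) :
    (fun z => (Tc τ ε)^[q] z - (p:ℂ))^[n] z = (Tc τ ε)^[q * n] z - (n * p : ℤ) := by
  induction n with
  | zero => simp
  | succ n ih =>
    rw [iterate_succ_apply', ih, mul_add, mul_one, add_comm (q * n), iterate_add_apply]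
    have := Tc_iter_add_int τ ε q ((Tc τ ε)^[q * n] z) (-(n * p))
    push_cast at this ⊢
    rw [← sub_eq_add_neg, ] at this
    rw [this]
    ring

lemma Bas_disj (τ ε : ℝ) (α β : ℝ) (q : ℕ) (p p' : ℤ)
    (hne : ∀ (j k : ℕ) (m : ℤ), (Tc τ ε)^[j] α ≠ (Tc τ ε)^[k] β + m) (r r' : ℝ)
    (h1 : ∀ z ∈ Metric.ball (α:ℂ) r,
      Tendsto (fun n => (fun z => (Tc τ ε)^[q] z - (p:ℂ))^[n] z) atTop (𝓝 (α:ℂ)))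
    (h2 : ∀ z ∈ Metric.ball (β:ℂ) r',
      Tendsto (fun n => (fun z => (Tc τ ε)^[q] z - (p':ℂ))^[n] z) atTop (𝓝 (β:ℂ))) (z : ℂ)
    (hz1 : z ∈ Bas τ ε α r) (hz2 : z ∈ Bas τ ε β r') : False := by
  obtain ⟨n, m, hn⟩ := hz1
  obtain ⟨k, l, hk⟩ := hz2
  have t1 := (((Tc_cont τ ε).iterate k).tendsto _).comp (h1 _ hn)
  have t2 := (((Tc_cont τ ε).iterate n).tendsto _).comp (h2 _ hk)
  have t3 := t1.sub t2
  have hmem : (Tc τ ε)^[k] α - (Tc τ ε)^[n] β ∈ range (Int.cast : ℤ → ℂ) := by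
    refine Complex.isClosed_range_intCast.mem_of_tendsto t3 (Eventually.of_forall fun j => ?_)
    refine ⟨m - j * p - (l - j * p'), ?_⟩
    simp only [Function.comp, Tc_iter_sub]
    have e1 := Tc_iter_add_int τ ε (q * j) ((Tc τ ε)^[n] z) m
    have e2 := Tc_iter_add_int τ ε (q * j) ((Tc τ ε)^[k] z) l
    rw [e1, e2, add_sub_assoc, add_sub_assoc]
    have e3 := Tc_iter_add_int τ ε k ((Tc τ ε)^[q * j] ((Tc τ ε)^[n] z)) (m - j * p)
    have e4 := Tc_iter_add_int τ ε n ((Tc τ ε)^[q * j] ((Tc τ ε)^[k] z)) (l - j * p')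
    push_cast at e3 e4 ⊢
    rw [e3, e4]
    simp only [← iterate_add_apply]
    rw [show k + (q * j + n) = n + (q * j + k) by ring]
    ring
  obtain ⟨m, hm⟩ := hmem
  exact hne k n m (by rw [hm]; ring)

lemma crit_eq (ε : ℝ) (hε : 0 < ε) (c : ℂ) (h : Tc' ε c = 0) :
    Complex.cos (2 * π * c) = 1 / (2 * π * ε) := by
  have h1 : (2 * π * ε : ℂ) ≠ 0 := by
    have : (2 * π * ε : ℝ) ≠ 0 := by positivity
    exact_mod_cast this
  rw [eq_div_iff h1]
  unfold Tc' at h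
  linear_combination -h

lemma crit_pair (ε : ℝ) (hε : 0 < ε) (c c' : ℂ) (h : Tc' ε c = 0) (h' : Tc' ε c' = 0) :
    ∃ k : ℤ, c' = c + k ∨ c' = - c + k := by
  have h1 := crit_eq ε hε c h
  have h2 := crit_eq ε hε c' h'
  obtain ⟨k, hk⟩ := Complex.cos_eq_cos_iff.1 (h1.trans h2.symm)
  have hpi : (π:ℂ) ≠ 0 := by exact_mod_cast Real.pi_ne_zero
  have h2pi : (2 * π:ℂ) ≠ 0 := by simp [hpi]
  refine ⟨k, ?_⟩
  rcases hk with hk | hk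
  · left
    apply mul_left_cancel₀ h2pi
    rw [hk]; ring
  · right
    apply mul_left_cancel₀ h2pi
    rw [hk]; ring

lemma crit_not_both (τ ε : ℝ) (hε : 0 < ε) (hεπ : 2 * π * ε < 1) (α β : ℝ) (r r' : ℝ)
    (hd : ∀ z, z ∈ Bas τ ε α r → z ∈ Bas τ ε β r' → False) (c c' : ℂ)
    (hc : c ∈ Bas τ ε α r) (hc' : c' ∈ Bas τ ε β r') (h : Tc' ε c = 0) (h' : Tc' ε c' = 0) :
    False := by
  obtain ⟨k, hk | hk⟩ := crit_pair ε hε c c' h h'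
  · exact hd c' (hk ▸ Bas_add _ _ _ _ _ k hc) hc'
  · have hcc : Tc' ε ((starRingEnd ℂ) c) = 0 := by
      have : (starRingEnd ℂ) (Tc' ε c) = 0 := by rw [h]; simp
      rw [← this]
      have h2 : (starRingEnd ℂ) (2:ℂ) = 2 := Complex.conj_ofNat 2
      simp [Tc', ← Complex.cos_conj, h2]
    obtain ⟨l, hl | hl⟩ := crit_pair ε hε c _ h hcc
    · have him : c.im = 0 := by
        have := congrArg Complex.im hl
        simp at this
        linarith
      have hre : c = (c.re : ℂ) := by apply Complex.ext <;> simp [him]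
      have h1 := crit_eq ε hε c h
      rw [hre] at h1
      have h2 : Real.cos (2 * π * c.re) = 1 / (2 * π * ε) := by exact_mod_cast h1
      have h3 := Real.cos_le_one (2 * π * c.re)
      rw [h2, div_le_one (by positivity)] at h3
      linarith
    · have : c' = (starRingEnd ℂ) c + (k - l : ℤ) := by
        rw [hk, hl]; push_cast; ring
      exact hd c' (this ▸ Bas_add _ _ _ _ _ _ (Bas_conj _ _ _ _ _ hc)) hc'

lemma fatou_half (τ ε : ℝ) (hε : 0 < ε) (α β : ℝ) (q : ℕ) (p : ℤ) (r r' : ℝ) (hr : 0 < r)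
    (hr' : 0 < r')
    (hfix : (Tc τ ε)^[q] α = α + p) (lam : ℂ) (hlam : HasDerivAt ((Tc τ ε)^[q]) lam α)
    (hl : ‖lam‖ < 1) (hd : ∀ z, z ∈ Bas τ ε α r → z ∈ Bas τ ε β r' → False)
    (hcrit : ∀ z ∈ Bas τ ε α r, Tc' ε z ≠ 0) : False := by
  set f : ℂ → ℂ := fun z => (Tc τ ε)^[q] z - (p:ℂ) with hf
  have hfα : f α = α := by simp [hf, hfix]
  have hfd : HasDerivAt f lam α := hlam.sub_const _
  have main : ∀ n : ℕ, ∃ G : ℂ → ℂ, DifferentiableOn ℂ G (Metric.ball (α:ℂ) r) ∧ G α = α ∧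
      (∀ w ∈ Metric.ball (α:ℂ) r, r' ≤ ‖G w - β‖) ∧
      ∀ w ∈ Metric.ball (α:ℂ) r, f^[n] (G w) = w := by
    intro n
    have hfn : f^[n] α = α := iterate_fixed hfα n
    rw [Tc_iter_sub] at hfn
    obtain ⟨G, g1, g2, g3, g4⟩ := Tc_lift_iter τ ε hε α r hr (Bas τ ε α r)
      (Bas_back τ ε α r) hcrit (q * n) id differentiableOn_id
      (fun w hw => ⟨0, 0, by simpa using hw⟩) ((α:ℂ) + ((-(n * p) : ℤ) : ℂ)) (by
        rw [Tc_iter_add_int]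
        push_cast at hfn ⊢
        simp only [id]
        linear_combination hfn)
    refine ⟨fun w => G w + ((n * p : ℤ) : ℂ), g1.add_const _, ?_, ?_, ?_⟩
    · simp only [g2]; push_cast; ring
    · intro w hw
      by_contra hcon
      push Not at hcon
      refine hd (G w + ((n * p : ℤ) : ℂ)) (Bas_add _ _ _ _ _ _ (g3 w hw)) ⟨0, 0, ?_⟩
      rw [Metric.mem_ball, Complex.dist_eq]
      simpa using hcon
    · intro w hw
      rw [Tc_iter_sub, Tc_iter_add_int, g4 w hw]
      simp
  -- derivative bound
  have bound : ∀ n : ℕ, 1 ≤ ‖lam‖ ^ n * (‖(α:ℂ) - β‖ ^ 2 * ((1 / r') / (r / 2))) := by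
    intro n
    obtain ⟨G, g1, g2, g3, g4⟩ := main n
    have hαD : (α:ℂ) ∈ Metric.ball (α:ℂ) r := Metric.mem_ball_self hr
    have hnn := Metric.isOpen_ball.mem_nhds hαD
    have hGd : HasDerivAt G (deriv G α) α := (g1.differentiableAt hnn).hasDerivAt
    have hne : ∀ w ∈ Metric.ball (α:ℂ) r, G w - β ≠ 0 := by
      intro w hw h0
      have := g3 w hw
      rw [h0, norm_zero] at this
      linarith
    have e1 : lam ^ n * deriv G α = 1 := by
      have h1 : HasDerivAt (f^[n]) (lam ^ n) (G α) := by
        rw [g2]; exact HasDerivAt.iterate _ hfd hfα n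
      have h2 := h1.comp (α:ℂ) hGd
      have h3 : (f^[n] ∘ G) =ᶠ[𝓝 (α:ℂ)] id := by
        filter_upwards [hnn] with w hw using g4 w hw
      exact (h2.congr_of_eventuallyEq h3.symm).unique (hasDerivAt_id _)
    let H : ℂ → ℂ := fun w => (G w - β)⁻¹
    have hHd : DifferentiableOn ℂ H (Metric.ball (α:ℂ) r) := (g1.sub_const _).inv hne
    have hH' : HasDerivAt H (-(deriv G α) / (G α - β) ^ 2) α :=
      (hGd.sub_const _).inv (hne _ hαD)
    have hsub : Metric.closedBall (α:ℂ) (r / 2) ⊆ Metric.ball (α:ℂ) r :=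
      Metric.closedBall_subset_ball (by linarith)
    have hHb := Complex.norm_deriv_le_of_forall_mem_sphere_norm_le (C := 1 / r')
      (show 0 < r / 2 by linarith) (f := H) (c := (α:ℂ))
      (DifferentiableOn.diffContOnCl (by
        rw [closure_ball _ (by linarith)]
        exact hHd.mono hsub)) (by
        intro z hz
        have hz' := hsub (Metric.sphere_subset_closedBall hz)
        simp only [H, norm_inv]
        rw [inv_eq_one_div]
        exact one_div_le_one_div_of_le hr' (g3 z hz'))
    rw [hH'.deriv, g2, norm_div, norm_neg, norm_pow, div_le_iff₀] at hHb
    swap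
    · have := hne _ hαD
      rw [g2] at this
      positivity
    have e2 : ‖lam‖ ^ n * ‖deriv G α‖ = 1 := by
      rw [← norm_pow, ← norm_mul, e1, norm_one]
    calc (1:ℝ) = ‖lam‖ ^ n * ‖deriv G α‖ := e2.symm
      _ ≤ _ := by
        apply mul_le_mul_of_nonneg_left _ (by positivity)
        linarith
  have t := (tendsto_pow_atTop_nhds_zero_of_lt_one (norm_nonneg lam) hl).mul_const
    (‖(α:ℂ) - β‖ ^ 2 * ((1 / r') / (r / 2)))
  rw [zero_mul] at t
  have := ge_of_tendsto' t bound
  linarith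

lemma fatou (τ ε : ℝ) (hε : 0 < ε) (hεπ : 2 * π * ε < 1) (α β : ℝ) (q : ℕ) (p p' : ℤ)
    (hα : (Tc τ ε)^[q] α = α + p) (hβ : (Tc τ ε)^[q] β = β + p') (lam mu : ℂ)
    (hlam : HasDerivAt ((Tc τ ε)^[q]) lam α) (hmu : HasDerivAt ((Tc τ ε)^[q]) mu β)
    (hl : ‖lam‖ < 1) (hm : ‖mu‖ < 1)
    (hne : ∀ (j k : ℕ) (m : ℤ), (Tc τ ε)^[j] α ≠ (Tc τ ε)^[k] β + m) : False := by
  obtain ⟨r, hr, h1⟩ := contr_disc (fun z => (Tc τ ε)^[q] z - (p:ℂ)) α lam (by simp [hα])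
    (hlam.sub_const _) hl
  obtain ⟨r', hr', h2⟩ := contr_disc (fun z => (Tc τ ε)^[q] z - (p':ℂ)) β mu (by simp [hβ])
    (hmu.sub_const _) hm
  have hd := Bas_disj τ ε α β q p p' hne r r' h1 h2
  by_cases hc : ∀ z ∈ Bas τ ε α r, Tc' ε z ≠ 0
  · exact fatou_half τ ε hε α β q p r r' hr hr' hα lam hlam hl hd hc
  by_cases hc' : ∀ z ∈ Bas τ ε β r', Tc' ε z ≠ 0
  · exact fatou_half τ ε hε β α q p' r' r hr' hr hβ mu hmu hm (fun z a b => hd z b a) hc'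
  push Not at hc hc'
  obtain ⟨c, hc, hc0⟩ := hc
  obtain ⟨c', hc', hc0'⟩ := hc'
  exact crit_not_both τ ε hε hεπ α β r r' hd c c' hc hc' hc0 hc0'

/-- real deterministic map -/
def Tr (τ ε : ℝ) (x : ℝ) : ℝ := x + τ - ε * Real.sin (2 * π * x)

lemma Tr_ofReal (τ ε x : ℝ) : Tc τ ε x = (Tr τ ε x : ℝ) := by
  simp [Tc, Tr]

lemma Tr_iter_ofReal (τ ε : ℝ) (n : ℕ) (x : ℝ) : (Tc τ ε)^[n] x = ((Tr τ ε)^[n] x : ℝ) := by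
  induction n generalizing x with
  | zero => rfl
  | succ n ih => rw [iterate_succ_apply, iterate_succ_apply, Tr_ofReal, ih]

lemma Tr_add_int (τ ε : ℝ) (x : ℝ) (m : ℤ) : Tr τ ε (x + m) = Tr τ ε x + m := by
  have h := Tc_add_int τ ε x m
  rw [Tr_ofReal, show (x:ℂ) + m = ((x + m : ℝ) : ℂ) by push_cast; rfl, Tr_ofReal] at h
  exact_mod_cast h

lemma Tr_iter_add_int (τ ε : ℝ) (n : ℕ) (x : ℝ) (m : ℤ) :
    (Tr τ ε)^[n] (x + m) = (Tr τ ε)^[n] x + m := by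
  induction n generalizing x with
  | zero => rfl
  | succ n ih => rw [iterate_succ_apply, iterate_succ_apply, Tr_add_int, ih]

lemma Tr_cont (τ ε : ℝ) : Continuous (Tr τ ε) := by unfold Tr; fun_prop

lemma Tr_hasDeriv (τ ε x : ℝ) : HasDerivAt (Tr τ ε) (1 - 2 * π * ε * Real.cos (2 * π * x)) x := by
  have h1 : HasDerivAt (fun z : ℝ => 2 * π * z) (2 * π) x := by
    simpa using (hasDerivAt_id x).const_mul (2 * π)
  have h2 := ((hasDerivAt_id x).add_const τ).sub ((h1.sin).const_mul ε)
  convert! h2 using 1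
  ring

lemma Tr_mono (τ ε : ℝ) (hε : 0 < ε) (hεπ : 2 * π * ε < 1) : Monotone (Tr τ ε) := by
  apply monotone_of_deriv_nonneg
  · exact fun x => (Tr_hasDeriv τ ε x).differentiableAt
  · intro x
    rw [(Tr_hasDeriv τ ε x).deriv]
    have := Real.cos_le_one (2 * π * x)
    have : 0 < 2 * π * ε := by positivity
    nlinarith

lemma Tr_iter_diff (τ ε : ℝ) (n : ℕ) : Differentiable ℝ ((Tr τ ε)^[n]) := by
  apply Differentiable.iterate
  exact fun x => (Tr_hasDeriv τ ε x).differentiableAt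

lemma Tc_iter_diff (τ ε : ℝ) (n : ℕ) : Differentiable ℂ ((Tc τ ε)^[n]) := by
  apply Differentiable.iterate
  exact fun x => (Tc_hasDeriv τ ε x).differentiableAt

lemma Tr_iter_mono (τ ε : ℝ) (hε : 0 < ε) (hεπ : 2 * π * ε < 1) (n : ℕ) :
    Monotone ((Tr τ ε)^[n]) := (Tr_mono τ ε hε hεπ).iterate n

lemma Tc_iter_deriv_real (τ ε : ℝ) (n : ℕ) (x d : ℝ) (h : HasDerivAt ((Tr τ ε)^[n]) d x) :
    HasDerivAt ((Tc τ ε)^[n]) (d:ℂ) x := by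
  have h1 := (Tc_iter_diff τ ε n x).hasDerivAt
  have h2 := h1.comp_ofReal
  have h3 := h.ofReal_comp
  have h4 : (fun y : ℝ => (Tc τ ε)^[n] y) = fun y => (((Tr τ ε)^[n] y : ℝ) : ℂ) := by
    ext y; exact Tr_iter_ofReal τ ε n y
  rw [h4] at h2
  rwa [h2.unique h3] at h1

/-- attracting cycles with non-equivalent orbits cannot coexist -/
lemma fatou_real (τ ε : ℝ) (hε : 0 < ε) (hεπ : 2 * π * ε < 1) (α β : ℝ) (q q' : ℕ)
    (hq : 0 < q) (hq' : 0 < q') (p p' : ℤ)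
    (hα : (Tr τ ε)^[q] α = α + p) (hβ : (Tr τ ε)^[q'] β = β + p')
    (hl : deriv ((Tr τ ε)^[q]) α < 1) (hm : deriv ((Tr τ ε)^[q']) β < 1)
    (hne : ∀ (j k : ℕ) (m : ℤ), (Tr τ ε)^[j] α ≠ (Tr τ ε)^[k] β + m) : False := by
  have key : ∀ (q q' : ℕ) (_ : 0 < q') (α : ℝ) (p : ℤ) (_ : (Tr τ ε)^[q] α = α + p)
      (_ : deriv ((Tr τ ε)^[q]) α < 1),
      (∃ P : ℤ, (Tc τ ε)^[q * q'] α = α + P) ∧ ∃ d : ℂ, HasDerivAt ((Tc τ ε)^[q * q']) d α ∧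
        ‖d‖ < 1 := by
    intro q q' hq' α p hα hl
    set lam := deriv ((Tr τ ε)^[q]) α with hlam
    have hl0 : 0 ≤ lam := (Tr_iter_mono τ ε hε hεπ q).deriv_nonneg
    have h1 : HasDerivAt ((Tc τ ε)^[q]) (lam:ℂ) α :=
      Tc_iter_deriv_real _ _ _ _ _ (Tr_iter_diff τ ε q α).hasDerivAt
    have h2 : (Tc τ ε)^[q] α = α + p := by rw [Tr_iter_ofReal, hα]; push_cast; rfl
    have h3 : (fun z => (Tc τ ε)^[q] z - (p:ℂ)) (α:ℂ) = α := by simp [h2]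
    have h4 : (fun z => (Tc τ ε)^[q] z - (p:ℂ))^[q'] = fun z => (Tc τ ε)^[q * q'] z - (q' * p : ℤ) := by
      ext z; exact Tc_iter_sub τ ε q p q' z
    have h5 := HasDerivAt.iterate _ (h1.sub_const (p:ℂ)) h3 q'
    rw [h4] at h5
    have h6 := iterate_fixed (f := fun z : ℂ => (Tc τ ε)^[q] z - (p:ℂ)) h3 q'
    rw [h4] at h6
    refine ⟨⟨q' * p, by rw [← sub_eq_iff_eq_add]; exact h6⟩, (lam:ℂ) ^ q', ?_, ?_⟩
    · simpa using h5.add_const ((q' * p : ℤ) : ℂ)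
    · rw [norm_pow, Complex.norm_real, Real.norm_of_nonneg hl0]
      exact pow_lt_one₀ hl0 hl hq'.ne'
  obtain ⟨⟨P, hP⟩, d, hd, hd1⟩ := key q q' hq' α p hα hl
  obtain ⟨⟨P', hP'⟩, d', hd', hd1'⟩ := key q' q hq β p' hβ hm
  rw [mul_comm q' q] at hP' hd'
  refine fatou τ ε hε hεπ α β (q * q') P P' hP hP' d d' hd hd' hd1 hd1' ?_
  intro j k m h
  rw [Tr_iter_ofReal, Tr_iter_ofReal] at h
  exact hne j k m (by exact_mod_cast h)

lemma Tr_shift (τ τ' ε x : ℝ) : Tr τ' ε x = Tr τ ε x + (τ' - τ) := by unfold Tr; ring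

lemma Tr_iter_tau (τ τ' ε : ℝ) (hε : 0 < ε) (hεπ : 2 * π * ε < 1) (h : τ ≤ τ') (n : ℕ) (x : ℝ) :
    (Tr τ ε)^[n + 1] x + (τ' - τ) ≤ (Tr τ' ε)^[n + 1] x := by
  have h0 : ∀ n, (Tr τ ε)^[n] x ≤ (Tr τ' ε)^[n] x := by
    intro n
    induction n with
    | zero => rfl
    | succ n ih =>
      rw [iterate_succ_apply', iterate_succ_apply', Tr_shift τ τ']
      have := Tr_mono τ ε hε hεπ ih
      linarith
  rw [iterate_succ_apply', iterate_succ_apply', Tr_shift τ τ']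
  have := Tr_mono τ ε hε hεπ (h0 n)
  linarith

/-- generic parameters give a hyperbolic attracting cycle -/
lemma hyperbolic_ae (τ ε s : ℝ) (hε : 0 < ε) (hεπ : 2 * π * ε < 1) (a b : ℝ)
    (hab : a < b) (q : ℕ) (p : ℤ)
    (hmap : ∀ τ' ∈ Ioo (τ - s) (τ + s), ∀ x ∈ Ioo a b, (Tr τ' ε)^[q + 1] x - p ∈ Ioo a b) :
    ∀ᵐ τ' ∂volume, τ' ∈ Ioo (τ - s) (τ + s) → ∃ x ∈ Ioo a b, (Tr τ' ε)^[q + 1] x = x + p ∧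
      deriv ((Tr τ' ε)^[q + 1]) x < 1 := by
  let F : ℝ → ℝ → ℝ := fun t x => (Tr t ε)^[q + 1] x - p
  have hFt : ∀ t t' x, t ≤ t' → F t x + (t' - t) ≤ F t' x := by
    intro t t' x h
    have := Tr_iter_tau t t' ε hε hεπ h q x
    simp only [F]; linarith
  have hFc : ∀ t, Continuous (F t) := fun t => ((Tr_cont t ε).iterate _).sub continuous_const
  have hFd : ∀ t, Differentiable ℝ (F t) := fun t => (Tr_iter_diff t ε _).sub_const _
  have hIcc : ∀ t ∈ Ioo (τ - s) (τ + s), ∀ x ∈ Icc a b, F t x ∈ Icc a b := by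
    intro t ht x hx
    have hm : MapsTo (F t) (Ioo a b) (Ioo a b) := hmap t ht
    have := hm.closure (hFc t)
    rw [closure_Ioo hab.ne] at this
    exact this hx
  have hFa : ∀ t ∈ Ioo (τ - s) (τ + s), a < F t a := by
    intro t ht
    obtain ⟨t', h1, h2⟩ := exists_between ht.1
    have h3 := (hIcc t' ⟨h1, h2.trans ht.2⟩ a ⟨le_rfl, hab.le⟩).1
    have := hFt t' t a h2.le
    linarith
  have hFb : ∀ t ∈ Ioo (τ - s) (τ + s), F t b < b := by
    intro t ht
    obtain ⟨t', h1, h2⟩ := exists_between ht.2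
    have h3 := (hIcc t' ⟨ht.1.trans h1, h2⟩ b ⟨hab.le, le_rfl⟩).2
    have := hFt t t' b h1.le
    linarith
  let S : ℝ → Set ℝ := fun t => {x | x ∈ Icc a b ∧ F t x ≤ x}
  let m : ℝ → ℝ := fun t => sInf (S t)
  have hSne : ∀ t ∈ Ioo (τ - s) (τ + s), b ∈ S t := fun t ht => ⟨⟨hab.le, le_rfl⟩, (hFb t ht).le⟩
  have hSbdd : ∀ t, BddBelow (S t) := fun t => ⟨a, fun x hx => hx.1.1⟩
  have hScl : ∀ t, IsClosed (S t) := fun t =>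
    isClosed_Icc.inter (isClosed_le (hFc t) continuous_id)
  have hmS : ∀ t ∈ Ioo (τ - s) (τ + s), m t ∈ S t := fun t ht =>
    (hScl t).csInf_mem ⟨b, hSne t ht⟩ (hSbdd t)
  have hma : ∀ t ∈ Ioo (τ - s) (τ + s), a < m t := by
    intro t ht
    refine lt_of_le_of_ne (hmS t ht).1.1 fun h => ?_
    have h1 := (hmS t ht).2
    rw [← h] at h1
    linarith [hFa t ht]
  have hlow : ∀ t, ∀ x, a ≤ x → x ≤ b → x < m t → x < F t x := by
    intro t x h1 h2 h3
    by_contra hcon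
    push Not at hcon
    have := csInf_le (hSbdd t) (show x ∈ S t from ⟨⟨h1, h2⟩, hcon⟩)
    have : m t ≤ x := this
    linarith
  have hfix : ∀ t ∈ Ioo (τ - s) (τ + s), F t (m t) = m t := by
    intro t ht
    apply le_antisymm (hmS t ht).2
    have h1 : Tendsto (F t) (𝓝[<] (m t)) (𝓝 (F t (m t))) :=
      (hFc t).continuousAt.mono_left nhdsWithin_le_nhds
    have h2 : Tendsto (fun x => x) (𝓝[<] (m t)) (𝓝 (m t)) :=
      tendsto_id.mono_left nhdsWithin_le_nhds
    refine le_of_tendsto_of_tendsto h2 h1 ?_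
    filter_upwards [Ioo_mem_nhdsLT (hma t ht)] with x hx
    exact (hlow t x hx.1.le (hx.2.le.trans (hmS t ht).1.2) hx.2).le
  have hmb : ∀ t ∈ Ioo (τ - s) (τ + s), m t < b := by
    intro t ht
    refine lt_of_le_of_ne (hmS t ht).1.2 fun h => ?_
    have h1 := hfix t ht
    rw [h] at h1
    linarith [hFb t ht]
  have hmono : MonotoneOn m (Ioo (τ - s) (τ + s)) := by
    intro t ht t' ht' h
    refine csInf_le_csInf (hSbdd t) ⟨b, hSne t' ht'⟩ ?_
    intro x hx
    exact ⟨hx.1, by linarith [hFt t t' x h, hx.2]⟩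
  have hle1 : ∀ t ∈ Ioo (τ - s) (τ + s), deriv (F t) (m t) ≤ 1 := by
    intro t ht
    have h1 := (hFd t (m t)).hasDerivAt
    have h2 := (hasDerivAt_iff_tendsto_slope.1 h1).mono_left
      (nhdsWithin_mono (m t) (show Iio (m t) ⊆ {m t}ᶜ from fun x hx => ne_of_lt hx))
    refine le_of_tendsto h2 ?_
    filter_upwards [Ioo_mem_nhdsLT (hma t ht)] with x hx
    rw [slope_def_field, hfix t ht]
    have := hlow t x hx.1.le (hx.2.le.trans (hmS t ht).1.2) hx.2
    rw [div_le_one_of_neg (by linarith [hx.2])]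
    linarith
  filter_upwards [hmono.ae_differentiableWithinAt_of_mem] with t htd ht
  have hdt : DifferentiableAt ℝ m t := (htd ht).differentiableAt (isOpen_Ioo.mem_nhds ht)
  refine ⟨m t, ⟨hma t ht, hmb t ht⟩, by have := hfix t ht; simp only [F] at this; linarith, ?_⟩
  have hd : deriv (F t) (m t) = deriv ((Tr t ε)^[q + 1]) (m t) := by
    simp only [F]; rw [deriv_sub_const]
  rw [← hd]
  refine lt_of_le_of_ne (hle1 t ht) fun h1 => ?_
  have hm' := hdt.hasDerivAt
  have hF' := (hFd t (m t)).hasDerivAt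
  rw [h1] at hF'
  have hφ : HasDerivAt (fun u => m u - F t (m u) - u) (deriv m t - 1 * deriv m t - 1) t :=
    (hm'.sub (hF'.comp t hm')).sub (hasDerivAt_id t)
  have h2 := (hasDerivAt_iff_tendsto_slope.1 hφ).mono_left
      (nhdsWithin_mono t (show Ioi t ⊆ {t}ᶜ from fun x hx => ne_of_gt hx))
  have h3 : (0:ℝ) ≤ deriv m t - 1 * deriv m t - 1 := by
    refine ge_of_tendsto h2 ?_
    filter_upwards [Ioo_mem_nhdsGT ht.2] with u hu
    have hu' : u ∈ Ioo (τ - s) (τ + s) := ⟨ht.1.trans hu.1, hu.2⟩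
    rw [slope_def_field]
    apply div_nonneg _ (by linarith [hu.1])
    rw [hfix t ht]
    have := hFt t u (m u) hu.1.le
    rw [hfix u hu'] at this
    linarith
  linarith

structure Trap (τ ε s : ℝ) (A : Set ℝ) : Prop where
  op : IsOpen A
  ne : A.Nonempty
  per : ∀ x ∈ A, ∀ m : ℤ, x + m ∈ A
  trap : ∀ z ∈ A, ∀ u, |u - Tr τ ε z| < s → u ∈ A

lemma Trap.iter {τ ε s : ℝ} {A : Set ℝ} (h : Trap τ ε s A) (τ' : ℝ)
    (hτ : τ' ∈ Ioo (τ - s) (τ + s)) (n : ℕ) (z : ℝ) (hz : z ∈ A) : (Tr τ' ε)^[n] z ∈ A := by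
  induction n with
  | zero => exact hz
  | succ n ih =>
    rw [iterate_succ_apply']
    refine h.trap _ ih _ ?_
    rw [Tr_shift τ τ', add_sub_cancel_left, abs_lt]
    constructor <;> linarith [hτ.1, hτ.2]

lemma pigeon (x : ℕ → ℝ) (s : ℝ) (hs : 0 < s) : ∃ (n q : ℕ) (p : ℤ),
    |x (n + q + 1) - x n - p| < s := by
  have h1 : ∀ n, Int.fract (x n) ∈ Icc (0:ℝ) 1 := fun n => ⟨Int.fract_nonneg _, (Int.fract_lt_one _).le⟩
  obtain ⟨y, -, φ, hφ, hy⟩ := isCompact_Icc.tendsto_subseq h1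
  have hc := hy.cauchySeq
  obtain ⟨N, hN⟩ := Metric.cauchySeq_iff.1 hc s hs
  have h2 := hN (N + 1) (by lia) N le_rfl
  have h3 : φ N < φ (N + 1) := hφ (by lia)
  obtain ⟨q, hq⟩ := Nat.exists_eq_add_of_lt h3
  refine ⟨φ N, q, ⌊x (φ (N+1))⌋ - ⌊x (φ N)⌋, ?_⟩
  rw [← hq]
  rw [Real.dist_eq] at h2
  simp only [Function.comp, Int.fract] at h2
  push_cast
  convert! h2 using 2
  ring

lemma Trap.interval {τ ε s : ℝ} (hs : 0 < s) {A B : Set ℝ}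
    (hA : Trap τ ε s A) (hB : Trap τ ε s B) (hd : Disjoint A B) :
    ∃ (a b : ℝ) (q : ℕ) (p : ℤ), a < b ∧ Ioo a b ⊆ A ∧
      ∀ τ' ∈ Ioo (τ - s) (τ + s), ∀ x ∈ Ioo a b, (Tr τ' ε)^[q + 1] x - p ∈ Ioo a b := by
  obtain ⟨z, hz⟩ := hA.ne
  obtain ⟨n, q, p, hp⟩ := pigeon (fun n => (Tr τ ε)^[n + 1] z) s hs
  have hτ : τ ∈ Ioo (τ - s) (τ + s) := ⟨by linarith, by linarith⟩
  set u := (Tr τ ε)^[n + 1] z with hu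
  have hpre : ∀ v ∈ Ioo (u - s) (u + s), v ∈ A := by
    intro v hv
    refine hA.trap _ (hA.iter τ hτ n z hz) v ?_
    rw [← iterate_succ_apply' (Tr τ ε), ← hu, abs_lt]
    constructor <;> linarith [hv.1, hv.2]
  have huI : u ∈ Ioo (u - s) (u + s) := ⟨by linarith, by linarith⟩
  have huA : u ∈ A := hpre u huI
  set C := connectedComponentIn A u with hC
  have hCA : C ⊆ A := connectedComponentIn_subset A u
  have hCo : IsOpen C := hA.op.connectedComponentIn
  have hCc : IsPreconnected C := isPreconnected_connectedComponentIn
  have huC : u ∈ C := mem_connectedComponentIn huA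
  obtain ⟨b0, hb0⟩ := hB.ne
  have hnB : ∀ m : ℤ, b0 + m ∉ C := fun m hm =>
    disjoint_left.1 hd (hCA hm) (hB.per _ hb0 m)
  have hbA : BddAbove C := by
    obtain ⟨m, hm⟩ := exists_int_gt (u - b0)
    refine ⟨b0 + m, fun x hx => ?_⟩
    by_contra hcon
    push Not at hcon
    exact hnB m (hCc.ordConnected.out huC hx ⟨by linarith, hcon.le⟩)
  have hbB : BddBelow C := by
    obtain ⟨m, hm⟩ := exists_int_lt (u - b0)
    refine ⟨b0 + m, fun x hx => ?_⟩
    by_contra hcon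
    push Not at hcon
    exact hnB m (hCc.ordConnected.out hx huC ⟨hcon.le, by linarith⟩)
  have hCeq : C = Ioo (sInf C) (sSup C) := by
    apply Subset.antisymm
    · have h1 : C ⊆ Icc (sInf C) (sSup C) := subset_Icc_csInf_csSup hbB hbA
      have := interior_mono h1
      rwa [hCo.interior_eq, interior_Icc] at this
    · exact (show IsConnected C from ⟨⟨u, huC⟩, hCc⟩).Ioo_csInf_csSup_subset hbB hbA
  -- the return map
  have hfA : ∀ τ' ∈ Ioo (τ - s) (τ + s), ∀ x ∈ A, (Tr τ' ε)^[q + 1] x - p ∈ A := by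
    intro τ' hτ' x hx
    have := hA.per _ (hA.iter τ' hτ' (q + 1) x hx) (-p)
    simpa [sub_eq_add_neg] using this
  have hIC : Ioo (u - s) (u + s) ⊆ C :=
    isPreconnected_Ioo.subset_connectedComponentIn huI hpre
  have hfu : (Tr τ ε)^[q + 1] u - p ∈ C := by
    apply hIC
    have h1 : (Tr τ ε)^[q + 1] u = (Tr τ ε)^[n + q + 1 + 1] z := by
      rw [hu, ← iterate_add_apply]; congr 1; lia
    rw [h1]
    rw [abs_lt] at hp
    constructor <;> linarith [hp.1, hp.2]
  have hcontτ : ∀ k : ℕ, Continuous fun t : ℝ => (Tr t ε)^[k] u := by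
    intro k
    induction k with
    | zero => exact continuous_const
    | succ k ih =>
      simp only [iterate_succ_apply']
      unfold Tr at ih ⊢
      fun_prop
  have hfu' : ∀ τ' ∈ Ioo (τ - s) (τ + s), (Tr τ' ε)^[q + 1] u - p ∈ C := by
    intro τ' hτ'
    have h1 : IsPreconnected ((fun t => (Tr t ε)^[q + 1] u - p) '' Ioo (τ - s) (τ + s)) :=
      isPreconnected_Ioo.image _ (((hcontτ _).sub continuous_const).continuousOn)
    have h2 := h1.subset_connectedComponentIn (F := A) ⟨τ, hτ, rfl⟩ (by
      rintro _ ⟨t, ht, rfl⟩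
      exact hfA t ht u huA)
    have h3 : connectedComponentIn A ((fun t => (Tr t ε)^[q + 1] u - p) τ) = C :=
      (connectedComponentIn_eq hfu).symm
    rw [h3] at h2
    exact h2 ⟨τ', hτ', rfl⟩
  refine ⟨sInf C, sSup C, q, p, ?_, hCeq ▸ hCA, ?_⟩
  · rw [hCeq] at huC; exact huC.1.trans huC.2
  · rw [← hCeq]
    intro τ' hτ' x hx
    have h1 : IsPreconnected ((fun x => (Tr τ' ε)^[q + 1] x - p) '' C) :=
      hCc.image _ ((((Tr_cont τ' ε).iterate _).sub continuous_const).continuousOn)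
    have h2 := h1.subset_connectedComponentIn (F := A) ⟨u, huC, rfl⟩ (by
      rintro _ ⟨y, hy, rfl⟩
      exact hfA τ' hτ' y (hCA hy))
    have h3 : connectedComponentIn A ((fun x => (Tr τ' ε)^[q + 1] x - p) u) = C :=
      (connectedComponentIn_eq (hfu' τ' hτ')).symm
    rw [h3] at h2
    exact h2 ⟨x, hx, rfl⟩

lemma no_two_traps {τ ε s : ℝ} (hε : 0 < ε) (hεπ : 2 * π * ε < 1) (hs : 0 < s) {A B : Set ℝ}
    (hA : Trap τ ε s A) (hB : Trap τ ε s B) (hd : Disjoint A B) : False := by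
  obtain ⟨a, b, q, p, hab, hsub, hm⟩ := hA.interval hs hB hd
  obtain ⟨a', b', q', p', hab', hsub', hm'⟩ := hB.interval hs hA hd.symm
  have h1 := hyperbolic_ae τ ε s hε hεπ a b hab q p hm
  have h2 := hyperbolic_ae τ ε s hε hεπ a' b' hab' q' p' hm'
  have h3 : ∃ t ∈ Ioo (τ - s) (τ + s), (∃ x ∈ Ioo a b, (Tr t ε)^[q + 1] x = x + p ∧
      deriv ((Tr t ε)^[q + 1]) x < 1) ∧ (∃ x ∈ Ioo a' b', (Tr t ε)^[q' + 1] x = x + p' ∧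
      deriv ((Tr t ε)^[q' + 1]) x < 1) := by
    by_contra hcon
    push Not at hcon
    have h4 : ∀ᵐ t ∂volume, t ∉ Ioo (τ - s) (τ + s) := by
      filter_upwards [h1, h2] with t g1 g2 ht
      obtain ⟨x, hx, e1, e2⟩ := g1 ht
      obtain ⟨y, hy, e3, e4⟩ := g2 ht
      have := hcon t ht ⟨x, hx, e1, e2⟩ y hy e3
      linarith
    rw [ae_iff] at h4
    simp only [not_not] at h4
    have h5 : volume (Ioo (τ - s) (τ + s)) = 0 := h4
    rw [Real.volume_Ioo, ENNReal.ofReal_eq_zero] at h5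
    linarith
  obtain ⟨t, ht, ⟨x, hx, e1, e2⟩, y, hy, e3, e4⟩ := h3
  refine fatou_real t ε hε hεπ x y (q + 1) (q' + 1) (by lia) (by lia) p p' e1 e3 e2 e4 ?_
  intro j k m h
  refine disjoint_left.1 hd (hA.iter t ht j x (hsub hx)) ?_
  rw [h]
  exact hB.per _ (hB.iter t ht k y (hsub' hy)) m

/-- reachable set by controls in the open interval -/
def Reach (τ ε σ : ℝ) : ℕ → ℝ → Set ℝ
  | 0, x => {x}
  | n + 1, x => {z | ∃ w ∈ Ioo (-(1/2) : ℝ) (1/2), z ∈ Reach τ ε σ n (Tr τ ε x + σ * w)}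

lemma Reach_fwd (τ ε σ : ℝ) (n : ℕ) (x z : ℝ) (hz : z ∈ Reach τ ε σ n x) (w : ℝ)
    (hw : w ∈ Ioo (-(1/2) : ℝ) (1/2)) : Tr τ ε z + σ * w ∈ Reach τ ε σ (n + 1) x := by
  induction n generalizing x with
  | zero =>
    have : z = x := hz
    subst this
    exact ⟨w, hw, rfl⟩
  | succ n ih =>
    obtain ⟨w', hw', h⟩ := hz
    exact ⟨w', hw', ih _ h⟩

def RA (τ ε σ x : ℝ) : Set ℝ :=
  {u | ∃ (n : ℕ) (z : ℝ) (m : ℤ), z ∈ Reach τ ε σ n x ∧ |u + m - Tr τ ε z| < σ / 2}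

lemma RA_mem (τ ε σ x u : ℝ) (hσ : 0 < σ) (h : u ∈ RA τ ε σ x) :
    ∃ (n : ℕ) (m : ℤ), u + m ∈ Reach τ ε σ (n + 1) x := by
  obtain ⟨n, z, m, hz, h⟩ := h
  refine ⟨n, m, ?_⟩
  rw [abs_lt] at h
  have := Reach_fwd τ ε σ n x z hz ((u + m - Tr τ ε z) / σ) (by
    constructor
    · rw [lt_div_iff₀ hσ]; linarith
    · rw [div_lt_iff₀ hσ]; linarith)
  rwa [mul_div_cancel₀ _ hσ.ne', add_sub_cancel] at this

lemma RA_trap (τ ε σ x : ℝ) (hσ : 0 < σ) : Trap τ ε (σ / 2) (RA τ ε σ x) where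
  op := by
    have : RA τ ε σ x = ⋃ (n : ℕ), ⋃ (z : ℝ), ⋃ (m : ℤ), ⋃ (_ : z ∈ Reach τ ε σ n x),
        {u : ℝ | |u + m - Tr τ ε z| < σ / 2} := by
      ext u; simp [RA]
    rw [this]
    refine isOpen_iUnion fun n => isOpen_iUnion fun z => isOpen_iUnion fun m =>
      isOpen_iUnion fun _ => isOpen_lt (by fun_prop) continuous_const
  ne := ⟨Tr τ ε x, 0, x, 0, rfl, by simpa using hσ⟩
  per := by
    rintro u ⟨n, z, m, hz, h⟩ k
    refine ⟨n, z, m - k, hz, ?_⟩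
    push_cast
    convert! h using 2
    ring
  trap := by
    intro z hz u hu
    obtain ⟨n, m, h⟩ := RA_mem τ ε σ x z hσ hz
    refine ⟨n + 1, z + m, m, h, ?_⟩
    rw [Tr_add_int]
    convert! hu using 2
    ring

lemma reach_meet (τ ε σ : ℝ) (hε : 0 < ε) (hεπ : 2 * π * ε < 1) (hσ : 0 < σ) (x y : ℝ) :
    ∃ (j k : ℕ) (z : ℝ) (m : ℤ), z ∈ Reach τ ε σ (j + 1) x ∧ z + m ∈ Reach τ ε σ (k + 1) y := by
  by_contra hcon
  push Not at hcon
  refine no_two_traps hε hεπ (half_pos hσ) (RA_trap τ ε σ x hσ) (RA_trap τ ε σ y hσ) ?_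
  rw [disjoint_left]
  intro u h1 h2
  obtain ⟨n, m, h1⟩ := RA_mem τ ε σ x u hσ h1
  obtain ⟨n', m', h2⟩ := RA_mem τ ε σ y u hσ h2
  refine hcon n n' _ (m' - m) h1 ?_
  push_cast
  convert! h2 using 1
  ring

def Pop (τ ε σ : ℝ) (g : ℝ → ℝ) (x : ℝ) : ℝ :=
  ∫ w in (-(1/2) : ℝ)..(1/2), g (Tr τ ε x + σ * w)

def Qop (τ ε σ : ℝ) (g : ℝ → ℝ) (x : ℝ) : ℝ := (g x + Pop τ ε σ g x) / 2

lemma Pop_cont (τ ε σ : ℝ) (g : ℝ → ℝ) (hg : Continuous g) : Continuous (Pop τ ε σ g) := by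
  unfold Pop
  apply intervalIntegral.continuous_parametric_intervalIntegral_of_continuous'
  have := Tr_cont τ ε
  fun_prop

lemma Qop_cont (τ ε σ : ℝ) (g : ℝ → ℝ) (hg : Continuous g) : Continuous (Qop τ ε σ g) :=
  (hg.add (Pop_cont τ ε σ g hg)).div_const 2

lemma Pop_ii (τ ε σ : ℝ) (g : ℝ → ℝ) (hg : Continuous g) (x a b : ℝ) :
    IntervalIntegrable (fun w => g (Tr τ ε x + σ * w)) volume a b :=
  Continuous.intervalIntegrable (by fun_prop) _ _

lemma Pop_mono (τ ε σ : ℝ) (g h : ℝ → ℝ) (hg : Continuous g) (hh : Continuous h)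
    (hgh : ∀ x, g x ≤ h x) (x : ℝ) : Pop τ ε σ g x ≤ Pop τ ε σ h x :=
  intervalIntegral.integral_mono_on (by norm_num) (Pop_ii τ ε σ g hg x _ _)
    (Pop_ii τ ε σ h hh x _ _) fun w _ => hgh _

lemma Pop_const (τ ε σ c x : ℝ) : Pop τ ε σ (fun _ => c) x = c := by
  simp only [Pop, intervalIntegral.integral_const]; norm_num

lemma Pop_lin (τ ε σ a b : ℝ) (g h : ℝ → ℝ) (hg : Continuous g) (hh : Continuous h) (x : ℝ) :
    Pop τ ε σ (fun x => a * g x + b * h x) x = a * Pop τ ε σ g x + b * Pop τ ε σ h x := by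
  unfold Pop
  rw [intervalIntegral.integral_add ((Pop_ii τ ε σ g hg x _ _).const_mul a)
    ((Pop_ii τ ε σ h hh x _ _).const_mul b), intervalIntegral.integral_const_mul,
    intervalIntegral.integral_const_mul]

lemma Qop_lin (τ ε σ a b : ℝ) (g h : ℝ → ℝ) (hg : Continuous g) (hh : Continuous h) :
    Qop τ ε σ (fun x => a * g x + b * h x) =
      fun x => a * Qop τ ε σ g x + b * Qop τ ε σ h x := by
  ext x
  simp only [Qop, Pop_lin τ ε σ a b g h hg hh]; ring

lemma Qop_iter_cont (τ ε σ : ℝ) (n : ℕ) (g : ℝ → ℝ) (hg : Continuous g) :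
    Continuous ((Qop τ ε σ)^[n] g) := by
  induction n with
  | zero => exact hg
  | succ n ih => rw [iterate_succ_apply']; exact Qop_cont _ _ _ _ ih

lemma Pop_iter_cont (τ ε σ : ℝ) (n : ℕ) (g : ℝ → ℝ) (hg : Continuous g) :
    Continuous ((Pop τ ε σ)^[n] g) := by
  induction n with
  | zero => exact hg
  | succ n ih => rw [iterate_succ_apply']; exact Pop_cont _ _ _ _ ih

lemma Qop_iter_lin (τ ε σ a b : ℝ) (n : ℕ) (g h : ℝ → ℝ) (hg : Continuous g) (hh : Continuous h) :
    (Qop τ ε σ)^[n] (fun x => a * g x + b * h x) =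
      fun x => a * (Qop τ ε σ)^[n] g x + b * (Qop τ ε σ)^[n] h x := by
  induction n with
  | zero => rfl
  | succ n ih =>
    simp only [iterate_succ_apply', ih]
    exact Qop_lin _ _ _ _ _ _ _ (Qop_iter_cont _ _ _ _ _ hg) (Qop_iter_cont _ _ _ _ _ hh)

lemma Qop_iter_const (τ ε σ c : ℝ) (n : ℕ) : (Qop τ ε σ)^[n] (fun _ => c) = fun _ => c := by
  induction n with
  | zero => rfl
  | succ n ih => rw [iterate_succ_apply', ih]; ext x; simp [Qop, Pop_const]

lemma Qop_iter_mono (τ ε σ : ℝ) (n : ℕ) (g h : ℝ → ℝ) (hg : Continuous g) (hh : Continuous h)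
    (hgh : ∀ x, g x ≤ h x) (x : ℝ) : (Qop τ ε σ)^[n] g x ≤ (Qop τ ε σ)^[n] h x := by
  induction n generalizing x with
  | zero => exact hgh x
  | succ n ih =>
    simp only [iterate_succ_apply', Qop]
    have := Pop_mono τ ε σ _ _ (Qop_iter_cont τ ε σ n g hg) (Qop_iter_cont τ ε σ n h hh) ih x
    linarith [ih x]

lemma Pop_iter_nonneg (τ ε σ : ℝ) (n : ℕ) (g : ℝ → ℝ) (hg : Continuous g)
    (h0 : ∀ x, 0 ≤ g x) (x : ℝ) : 0 ≤ (Pop τ ε σ)^[n] g x := by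
  induction n generalizing x with
  | zero => exact h0 x
  | succ n ih =>
    rw [iterate_succ_apply']
    have := Pop_mono τ ε σ _ _ continuous_const (Pop_iter_cont τ ε σ n g hg) ih x
    rwa [Pop_const] at this

lemma Qop_iter_nonneg (τ ε σ : ℝ) (n : ℕ) (g : ℝ → ℝ) (hg : Continuous g)
    (h0 : ∀ x, 0 ≤ g x) (x : ℝ) : 0 ≤ (Qop τ ε σ)^[n] g x := by
  have := Qop_iter_mono τ ε σ n (fun _ => 0) g continuous_const hg h0 x
  rwa [Qop_iter_const] at this

lemma Pop_per (τ ε σ : ℝ) (g : ℝ → ℝ) (hp : Periodic g 1) : Periodic (Pop τ ε σ g) 1 := by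
  intro x
  unfold Pop
  congr 1
  ext w
  have := Tr_add_int τ ε x 1
  push_cast at this
  rw [this, ← hp (Tr τ ε x + σ * w)]
  congr 1; ring

lemma Qop_per (τ ε σ : ℝ) (g : ℝ → ℝ) (hp : Periodic g 1) : Periodic (Qop τ ε σ g) 1 := by
  intro x
  simp only [Qop, Pop_per τ ε σ g hp x, hp x]

lemma Qop_iter_per (τ ε σ : ℝ) (n : ℕ) (g : ℝ → ℝ) (hp : Periodic g 1) :
    Periodic ((Qop τ ε σ)^[n] g) 1 := by
  induction n with
  | zero => exact hp
  | succ n ih => rw [iterate_succ_apply']; exact Qop_per _ _ _ _ ih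

lemma per_int (g : ℝ → ℝ) (hp : Periodic g 1) (x : ℝ) (m : ℤ) : g (x + m) = g x := by
  simpa using hp.int_mul m x

lemma Qop_tau_int (τ ε σ : ℝ) (g : ℝ → ℝ) (hp : Periodic g 1) (m : ℤ) :
    Qop (τ + m) ε σ g = Qop τ ε σ g := by
  ext x
  simp only [Qop, Pop]
  congr 2
  congr 1
  ext w
  rw [Tr_shift τ, ← per_int g hp (Tr τ ε x + σ * w) m]
  congr 1; ring

lemma Qop_iter_tau_int (τ ε σ : ℝ) (n : ℕ) (g : ℝ → ℝ) (hp : Periodic g 1) (m : ℤ) :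
    (Qop (τ + m) ε σ)^[n] g = (Qop τ ε σ)^[n] g := by
  induction n with
  | zero => rfl
  | succ n ih =>
    rw [iterate_succ_apply', iterate_succ_apply', ih, Qop_tau_int]
    exact Qop_iter_per _ _ _ _ _ hp

lemma Qop_ge_Pop (τ ε σ : ℝ) (g : ℝ → ℝ) (hg : Continuous g)
    (h0 : ∀ x, 0 ≤ g x) (n j : ℕ) (hj : j ≤ n) (x : ℝ) :
    (1/2) ^ n * (Pop τ ε σ)^[j] g x ≤ (Qop τ ε σ)^[n] g x := by
  induction n generalizing j x with
  | zero =>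
    have : j = 0 := by lia
    subst this; simp
  | succ n ih =>
    have hc := Qop_iter_cont τ ε σ n g hg
    rw [iterate_succ_apply', Qop]
    rcases Nat.lt_or_ge n j with h | h
    · have : j = n + 1 := by lia
      subst this
      have h1 : Pop τ ε σ (fun y => (1/2) ^ n * (Pop τ ε σ)^[n] g y + 0 * (0:ℝ)) x ≤
          Pop τ ε σ ((Qop τ ε σ)^[n] g) x :=
        Pop_mono τ ε σ _ _ (by have := Pop_iter_cont τ ε σ n g hg; fun_prop) hc
          (fun y => by simpa using ih n le_rfl y) x
      rw [Pop_lin τ ε σ ((1/2) ^ n) 0 _ (fun _ => 0) (Pop_iter_cont τ ε σ n g hg)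
        continuous_const] at h1
      have h2 := Qop_iter_nonneg τ ε σ n g hg h0 x
      rw [iterate_succ_apply', pow_succ]
      linarith
    · have h1 := ih j h x
      have h2 : 0 ≤ Pop τ ε σ ((Qop τ ε σ)^[n] g) x := by
        have := Pop_mono τ ε σ _ _ continuous_const hc (Qop_iter_nonneg τ ε σ n g hg h0) x
        rwa [Pop_const] at this
      rw [pow_succ]
      linarith

lemma int_mono (g : ℝ → ℝ) (hg : Continuous g) (h0 : ∀ x, 0 ≤ g x) (a b c d : ℝ)
    (h1 : c ≤ a) (h2 : a ≤ b) (h3 : b ≤ d) : ∫ x in a..b, g x ≤ ∫ x in c..d, g x :=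
  intervalIntegral.integral_mono_interval h1 h2 h3 (Eventually.of_forall h0)
    (hg.intervalIntegrable _ _)

lemma Pop_eq (τ ε σ : ℝ) (hσ : 0 < σ) (g : ℝ → ℝ) (x : ℝ) :
    Pop τ ε σ g x = σ⁻¹ * ∫ u in (Tr τ ε x - σ / 2)..(Tr τ ε x + σ / 2), g u := by
  unfold Pop
  rw [intervalIntegral.integral_comp_add_mul g hσ.ne', smul_eq_mul]
  congr 2 <;> ring

lemma minor_one (τ ε σ : ℝ) (hσ : 0 < σ) (x w : ℝ) (hw : w ∈ Ioo (-(1/2) : ℝ) (1/2)) :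
    ∃ δ > 0, ∀ τ' x', |τ' - τ| < δ → |x' - x| < δ → ∀ g : ℝ → ℝ, Continuous g →
      (∀ u, 0 ≤ g u) →
      σ⁻¹ * (∫ u in (Tr τ ε x + σ * w - δ)..(Tr τ ε x + σ * w + δ), g u) ≤ Pop τ' ε σ g x' := by
  obtain ⟨hw1, hw2⟩ := hw
  set η := min (σ / 2 - σ * w) (σ / 2 + σ * w) / 2 with hη
  have h1 : 0 < σ / 2 - σ * w := by nlinarith
  have h2 : 0 < σ / 2 + σ * w := by nlinarith
  have hη0 : 0 < η := by positivity
  have hη1 : 2 * η ≤ σ / 2 - σ * w := by have := min_le_left (σ / 2 - σ * w) (σ / 2 + σ * w); linarith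
  have hη2 : 2 * η ≤ σ / 2 + σ * w := by have := min_le_right (σ / 2 - σ * w) (σ / 2 + σ * w); linarith
  have hc : ContinuousAt (fun p : ℝ × ℝ => Tr p.1 ε p.2) (τ, x) := by
    unfold Tr; fun_prop
  obtain ⟨δ, hδ, hball⟩ := Metric.continuousAt_iff.1 hc η hη0
  refine ⟨min δ η, lt_min hδ hη0, fun τ' x' h3 h4 g hg h0 => ?_⟩
  have h5 := hball (x := (τ', x')) (by
    rw [Prod.dist_eq, Real.dist_eq, Real.dist_eq]
    exact max_lt (h3.trans_le (min_le_left _ _)) (h4.trans_le (min_le_left _ _)))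
  rw [Real.dist_eq, abs_lt] at h5
  simp only at h5
  rw [Pop_eq τ' ε σ hσ]
  have h6 := min_le_right δ η
  have h7 : 0 < min δ η := lt_min hδ hη0
  apply mul_le_mul_of_nonneg_left _ (by positivity)
  apply int_mono g hg h0 <;> linarith

lemma minor (τ ε σ : ℝ) (hσ : 0 < σ) (j : ℕ) (x z : ℝ) (hz : z ∈ Reach τ ε σ (j + 1) x) :
    ∃ c > 0, ∃ δ > 0, ∀ τ' x', |τ' - τ| < δ → |x' - x| < δ → ∀ g : ℝ → ℝ, Continuous g →
      (∀ u, 0 ≤ g u) →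
      c * (∫ u in (z - δ)..(z + δ), g u) ≤ (Pop τ' ε σ)^[j + 1] g x' := by
  induction j generalizing x with
  | zero =>
    obtain ⟨w, hw, h⟩ := hz
    have h : z = _ := h
    obtain ⟨δ, hδ, H⟩ := minor_one τ ε σ hσ x w hw
    rw [← h] at H
    exact ⟨σ⁻¹, by positivity, δ, hδ, H⟩
  | succ j ih =>
    obtain ⟨w, hw, h⟩ := hz
    obtain ⟨c, hc, δ, hδ, H⟩ := ih _ h
    obtain ⟨δ', hδ', H'⟩ := minor_one τ ε σ hσ x w hw
    set y := Tr τ ε x + σ * w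
    set η := min (δ / 2) δ' with hη
    have hη0 : 0 < η := lt_min (by linarith) hδ'
    have hη1 : η ≤ δ / 2 := min_le_left _ _
    have hη2 : η ≤ δ' := min_le_right _ _
    refine ⟨σ⁻¹ * (2 * η * c), by positivity, η, hη0, fun τ' x' h1 h2 g hg h0 => ?_⟩
    have hcont := Pop_iter_cont τ' ε σ (j + 1) g hg
    have hnn := Pop_iter_nonneg τ' ε σ (j + 1) g hg h0
    have A := H' τ' x' (h1.trans_le hη2) (h2.trans_le hη2) _ hcont hnn
    rw [iterate_succ_apply']
    refine le_trans ?_ A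
    rw [mul_assoc]
    apply mul_le_mul_of_nonneg_left _ (by positivity)
    refine le_trans ?_ (int_mono _ hcont hnn (y - η) (y + η) _ _ (by linarith) (by linarith)
      (by linarith))
    have B : ∫ u in (y - η)..(y + η), (c * ∫ u in (z - η)..(z + η), g u) ≤
        ∫ u in (y - η)..(y + η), (Pop τ' ε σ)^[j + 1] g u := by
      refine intervalIntegral.integral_mono_on (by linarith) (by simp)
        (hcont.intervalIntegrable _ _) fun u hu => ?_
      refine le_trans ?_ (H τ' u (by linarith) (by rw [abs_lt]; constructor <;> linarith [hu.1, hu.2])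
        g hg h0)
      exact mul_le_mul_of_nonneg_left (int_mono g hg h0 _ _ _ _ (by linarith) (by linarith)
        (by linarith)) hc.le
    rw [intervalIntegral.integral_const, smul_eq_mul] at B
    refine le_trans (le_of_eq ?_) B
    ring

/-- test functions -/
def TF (g : ℝ → ℝ) : Prop := Continuous g ∧ Periodic g 1 ∧ ∀ x, 0 ≤ g x ∧ g x ≤ 1

lemma TF_iter (τ ε σ : ℝ) (n : ℕ) (g : ℝ → ℝ) (hg : TF g) : TF ((Qop τ ε σ)^[n] g) := by
  obtain ⟨h1, h2, h3⟩ := hg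
  refine ⟨Qop_iter_cont _ _ _ _ _ h1, Qop_iter_per _ _ _ _ _ h2, fun x => ⟨?_, ?_⟩⟩
  · exact Qop_iter_nonneg _ _ _ _ _ h1 (fun x => (h3 x).1) x
  · have := Qop_iter_mono τ ε σ n g (fun _ => 1) h1 continuous_const (fun x => (h3 x).2) x
    rwa [Qop_iter_const] at this

lemma local_contr (ε σ : ℝ) (hε : 0 < ε) (hεπ : 2 * π * ε < 1) (hσ : 0 < σ) (τ x y : ℝ) :
    ∃ (n : ℕ) (θ : ℝ) (δ : ℝ), θ < 1 ∧ 0 < δ ∧ ∀ τ' x' y', |τ' - τ| < δ → |x' - x| < δ →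
      |y' - y| < δ → ∀ g, TF g → (Qop τ' ε σ)^[n] g x' - (Qop τ' ε σ)^[n] g y' ≤ θ := by
  obtain ⟨j, k, z, m, hz1, hz2⟩ := reach_meet τ ε σ hε hεπ hσ x y
  obtain ⟨c1, hc1, δ1, hδ1, H1⟩ := minor τ ε σ hσ j x z hz1
  obtain ⟨c2, hc2, δ2, hδ2, H2⟩ := minor τ ε σ hσ k y _ hz2
  set n := max (j + 1) (k + 1)
  set c := min c1 c2
  set δ := min δ1 δ2
  have hc : 0 < c := lt_min hc1 hc2
  have hδ : 0 < δ := lt_min hδ1 hδ2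
  have hδ1' : δ ≤ δ1 := min_le_left _ _
  have hδ2' : δ ≤ δ2 := min_le_right _ _
  refine ⟨n, 1 - (1/2) ^ n * (c * (2 * δ)), δ, ?_, hδ, ?_⟩
  · have : 0 < (1/2:ℝ) ^ n * (c * (2 * δ)) := by positivity
    linarith
  intro τ' x' y' h1 h2 h3 g hg
  have L1 : ∀ g : ℝ → ℝ, Continuous g → (∀ x, 0 ≤ g x) →
      (1/2) ^ n * (c * ∫ u in (z - δ)..(z + δ), g u) ≤ (Qop τ' ε σ)^[n] g x' := by
    intro g hg h0
    refine le_trans ?_ (Qop_ge_Pop τ' ε σ g hg h0 n (j + 1) (le_max_left _ _) x')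
    apply mul_le_mul_of_nonneg_left _ (by positivity)
    refine le_trans ?_ (H1 τ' x' (h1.trans_le hδ1') (h2.trans_le hδ1') g hg h0)
    apply mul_le_mul (min_le_left _ _) _ _ hc1.le
    · apply int_mono g hg h0 <;> linarith
    · exact intervalIntegral.integral_nonneg (by linarith) fun u _ => h0 u
  have L2 : ∀ g : ℝ → ℝ, Continuous g → (∀ x, 0 ≤ g x) →
      (1/2) ^ n * (c * ∫ u in (z + m - δ)..(z + m + δ), g u) ≤ (Qop τ' ε σ)^[n] g y' := by
    intro g hg h0
    refine le_trans ?_ (Qop_ge_Pop τ' ε σ g hg h0 n (k + 1) (le_max_right _ _) y')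
    apply mul_le_mul_of_nonneg_left _ (by positivity)
    refine le_trans ?_ (H2 τ' y' (h1.trans_le hδ2') (h3.trans_le hδ2') g hg h0)
    apply mul_le_mul (min_le_right _ _) _ _ hc2.le
    · apply int_mono g hg h0 <;> linarith
    · exact intervalIntegral.integral_nonneg (by linarith) fun u _ => h0 u
  obtain ⟨g1, g2, g3⟩ := hg
  have e1 := L1 (fun x => 1 * 1 + (-1) * g x) (by fun_prop) (fun x => by linarith [(g3 x).2])
  have e2 := L2 g g1 (fun x => (g3 x).1)
  rw [Qop_iter_lin τ' ε σ 1 (-1) n (fun _ => 1) g continuous_const g1, Qop_iter_const,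
    intervalIntegral.integral_add (by simp) ((g1.intervalIntegrable _ _).const_mul _),
    intervalIntegral.integral_const_mul, intervalIntegral.integral_const_mul] at e1
  have e3 : ∫ u in (z + m - δ)..(z + m + δ), g u = ∫ u in (z - δ)..(z + δ), g u := by
    rw [show z + m - δ = (z - δ) + m by ring, show z + m + δ = (z + δ) + m by ring,
      ← intervalIntegral.integral_comp_add_right]
    congr 1
    ext u
    exact per_int g g2 u m
  rw [e3] at e2
  simp only [intervalIntegral.integral_const, smul_eq_mul] at e1
  set I := ∫ u in (z - δ)..(z + δ), g u
  have : (1/2:ℝ) ^ n * (c * (1 * ((z + δ - (z - δ)) * 1) + -1 * I)) =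
      (1/2:ℝ) ^ n * (c * (2 * δ)) - (1/2:ℝ) ^ n * (c * I) := by ring
  linarith

lemma global_contr (ε σ : ℝ) (hε : 0 < ε) (hεπ : 2 * π * ε < 1) (hσ : 0 < σ) :
    ∃ (N : ℕ) (θ : ℝ), θ < 1 ∧ ∀ τ x y, ∀ n ≥ N, ∀ g, TF g →
      (Qop τ ε σ)^[n] g x - (Qop τ ε σ)^[n] g y ≤ θ := by
  let K : Set (ℝ × ℝ × ℝ) := Icc 0 1 ×ˢ Icc 0 1 ×ˢ Icc 0 1
  have hK : IsCompact K := isCompact_Icc.prod (isCompact_Icc.prod isCompact_Icc)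
  let p : Set (ℝ × ℝ × ℝ) → Prop := fun S => ∃ (N : ℕ) (θ : ℝ), θ < 1 ∧ ∀ q ∈ S, ∀ n ≥ N, ∀ g,
    TF g → (Qop q.1 ε σ)^[n] g q.2.1 - (Qop q.1 ε σ)^[n] g q.2.2 ≤ θ
  have hp : p K := by
    refine hK.induction_on (p := p) ⟨0, 0, by norm_num, by simp⟩ ?_ ?_ ?_
    · rintro S S' hS ⟨N, θ, h1, h2⟩
      exact ⟨N, θ, h1, fun q hq => h2 q (hS hq)⟩
    · rintro S S' ⟨N, θ, h1, h2⟩ ⟨N', θ', h1', h2'⟩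
      refine ⟨max N N', max θ θ', max_lt h1 h1', ?_⟩
      rintro q (hq | hq) n hn g hg
      · exact (h2 q hq n (le_trans (le_max_left _ _) hn) g hg).trans (le_max_left _ _)
      · exact (h2' q hq n (le_trans (le_max_right _ _) hn) g hg).trans (le_max_right _ _)
    · rintro ⟨τ, x, y⟩ -
      obtain ⟨N, θ, δ, hθ, hδ, H⟩ := local_contr ε σ hε hεπ hσ τ x y
      refine ⟨Metric.ball (τ, x, y) δ, mem_nhdsWithin_of_mem_nhds (Metric.ball_mem_nhds _ hδ),
        N, θ, hθ, ?_⟩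
      rintro ⟨τ', x', y'⟩ hq n hn g hg
      rw [Metric.mem_ball, Prod.dist_eq, Prod.dist_eq, max_lt_iff, max_lt_iff] at hq
      obtain ⟨q, rfl⟩ := Nat.exists_eq_add_of_le hn
      simp only [iterate_add_apply]
      exact H τ' x' y' hq.1 hq.2.1 hq.2.2 _ (TF_iter _ _ _ _ _ hg)
  obtain ⟨N, θ, hθ, H⟩ := hp
  refine ⟨N, θ, hθ, fun τ x y n hn g hg => ?_⟩
  have hfr : ∀ x : ℝ, Int.fract x ∈ Icc (0:ℝ) 1 :=
    fun x => ⟨Int.fract_nonneg _, (Int.fract_lt_one _).le⟩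
  have := H (Int.fract τ, Int.fract x, Int.fract y) ⟨hfr τ, hfr x, hfr y⟩ n hn g hg
  simp only at this
  have h1 : (Qop τ ε σ)^[n] g = (Qop (Int.fract τ) ε σ)^[n] g := by
    conv_lhs => rw [← Int.fract_add_floor τ]
    exact Qop_iter_tau_int _ _ _ _ _ hg.2.1 _
  have h2 : ∀ x, (Qop τ ε σ)^[n] g x = (Qop τ ε σ)^[n] g (Int.fract x) := by
    intro x
    conv_lhs => rw [← Int.fract_add_floor x]
    exact per_int _ (Qop_iter_per _ _ _ _ _ hg.2.1) _ _
  rw [h2 x, h2 y, h1]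
  exact this

lemma osc_iter (τ ε σ : ℝ) (n : ℕ) (g : ℝ → ℝ) (hg : Continuous g) (M : ℝ)
    (h : ∀ x y, g x - g y ≤ M) (x y : ℝ) :
    (Qop τ ε σ)^[n] g x - (Qop τ ε σ)^[n] g y ≤ M := by
  have h1 : ∀ y x, (Qop τ ε σ)^[n] g x ≤ g y + M := by
    intro y x
    have := Qop_iter_mono τ ε σ n g (fun _ => g y + M) hg continuous_const
      (fun x => by linarith [h x y]) x
    rwa [Qop_iter_const] at this
  have := Qop_iter_mono τ ε σ n (fun _ => (Qop τ ε σ)^[n] g x - M) g continuous_const hg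
      (fun y => by linarith [h1 y x]) y
  rw [Qop_iter_const] at this
  linarith

lemma scaled_contr (ε σ : ℝ) (hε : 0 < ε) (hεπ : 2 * π * ε < 1) (hσ : 0 < σ) :
    ∃ (N : ℕ) (θ : ℝ), 0 < N ∧ 0 < θ ∧ θ < 1 ∧ ∀ τ g M, Continuous g → Periodic g 1 → 0 ≤ M →
      (∀ x y, g x - g y ≤ M) → ∀ x y,
      (Qop τ ε σ)^[N] g x - (Qop τ ε σ)^[N] g y ≤ θ * M := by
  obtain ⟨N, θ, hθ, H⟩ := global_contr ε σ hε hεπ hσ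
  have key : ∀ τ g M, Continuous g → Periodic g 1 → 0 < M →
      (∀ x y, g x - g y ≤ M) → ∀ x y,
      (Qop τ ε σ)^[N + 1] g x - (Qop τ ε σ)^[N + 1] g y ≤ (max θ (1/2)) * M := by
    intro τ g M hg hp hM h x y
    have hbdd : BddBelow (range g) := ⟨g 0 - M, by rintro _ ⟨x, rfl⟩; linarith [h 0 x]⟩
    set i := sInf (range g)
    have hi : ∀ x, i ≤ g x := fun x => csInf_le hbdd ⟨x, rfl⟩
    have hi2 : ∀ x, g x - M ≤ i := fun x =>
      le_csInf ⟨g 0, 0, rfl⟩ (by rintro _ ⟨y, rfl⟩; linarith [h x y])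
    have hT : TF (fun x => M⁻¹ * g x + (-(M⁻¹ * i)) * 1) := by
      refine ⟨by fun_prop, fun x => by simp only [hp x], fun x => ?_⟩
      have e : M⁻¹ * g x + (-(M⁻¹ * i)) * 1 = (g x - i) / M := by field_simp; ring
      simp only [e]
      exact ⟨div_nonneg (by linarith [hi x]) hM.le, by
        rw [div_le_one hM]; linarith [hi2 x]⟩
    have := H τ x y (N + 1) (by lia) _ hT
    rw [Qop_iter_lin τ ε σ _ _ (N + 1) g (fun _ => 1) hg continuous_const, Qop_iter_const] at this
    have h2 : M⁻¹ * ((Qop τ ε σ)^[N + 1] g x - (Qop τ ε σ)^[N + 1] g y) ≤ θ := by linarith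
    rw [inv_mul_le_iff₀ hM] at h2
    have := le_max_left θ (1/2)
    nlinarith
  refine ⟨N + 1, max θ (1/2), by lia, lt_max_of_lt_right (by norm_num),
    max_lt hθ (by norm_num), fun τ g M hg hp hM h x y => ?_⟩
  rcases hM.eq_or_lt with hM | hM
  · rw [← hM, mul_zero]
    exact osc_iter τ ε σ _ g hg 0 (by rw [hM]; exact h) x y
  · exact key τ g M hg hp hM h x y

lemma expo_contr (ε σ : ℝ) (hε : 0 < ε) (hεπ : 2 * π * ε < 1) (hσ : 0 < σ) :
    ∃ (K ρ : ℝ), 0 < K ∧ 0 < ρ ∧ ρ < 1 ∧ ∀ τ g M, Continuous g → Periodic g 1 → 0 ≤ M →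
      (∀ x y, g x - g y ≤ M) → ∀ k x y,
      (Qop τ ε σ)^[k] g x - (Qop τ ε σ)^[k] g y ≤ K * M * ρ ^ k := by
  obtain ⟨N, θ, hN, h0, h1, H⟩ := scaled_contr ε σ hε hεπ hσ
  set ρ := θ ^ ((N:ℝ)⁻¹) with hρ
  have hρ0 : 0 < ρ := Real.rpow_pos_of_pos h0 _
  have hρN : ρ ^ N = θ := Real.rpow_inv_natCast_pow h0.le hN.ne'
  have hρ1 : ρ < 1 := Real.rpow_lt_one h0.le h1 (by positivity)
  refine ⟨θ⁻¹, ρ, by positivity, hρ0, hρ1, ?_⟩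
  intro τ g M hg hp hM h k
  induction k using Nat.strong_induction_on generalizing g M with
  | _ k ih =>
  intro x y
  rcases Nat.lt_or_ge k N with hk | hk
  · refine (osc_iter τ ε σ k g hg M h x y).trans ?_
    have h2 : θ ≤ ρ ^ k := by
      rw [← hρN]; exact pow_le_pow_of_le_one hρ0.le hρ1.le hk.le
    calc M = θ⁻¹ * M * θ := by field_simp
      _ ≤ _ := by gcongr
  · obtain ⟨l, rfl⟩ := Nat.exists_eq_add_of_le hk
    have h2 := ih l (by lia) ((Qop τ ε σ)^[N] g) (θ * M) (Qop_iter_cont _ _ _ _ _ hg)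
      (Qop_iter_per _ _ _ _ _ hp) (by positivity) (H τ g M hg hp hM h) x y
    rw [← iterate_add_apply, add_comm l N] at h2
    refine h2.trans (le_of_eq ?_)
    rw [pow_add, hρN]; ring

lemma hasFDerivAt_param (a b : ℝ) {E : Type} [NormedAddCommGroup E] [NormedSpace ℝ E]
    (f : (ℝ × ℝ) × ℝ → E) (hf : ContDiff ℝ 1 f) (p : ℝ × ℝ) :
    HasFDerivAt (fun p => ∫ w in a..b, f (p, w))
      (∫ w in a..b, (fderiv ℝ f (p, w)).comp (ContinuousLinearMap.inl ℝ (ℝ × ℝ) ℝ)) p := by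
  have hd : Differentiable ℝ f := hf.differentiable one_ne_zero
  have hfc : Continuous f := hf.continuous
  have hf'c : Continuous fun z => (fderiv ℝ f z).comp (ContinuousLinearMap.inl ℝ (ℝ × ℝ) ℝ) :=
    (hf.continuous_fderiv one_ne_zero).clm_comp continuous_const
  obtain ⟨C, hC⟩ := ((isCompact_closedBall p 1).prod (isCompact_uIcc (a := a) (b := b))
    ).exists_bound_of_continuousOn hf'c.continuousOn
  refine intervalIntegral.hasFDerivAt_integral_of_dominated_of_fderiv_le
    (F' := fun p w => (fderiv ℝ f (p, w)).comp (ContinuousLinearMap.inl ℝ (ℝ × ℝ) ℝ))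
    (bound := fun _ => C)
    (Metric.closedBall_mem_nhds p one_pos) ?_ ?_ ?_ ?_ ?_ ?_
  · refine Eventually.of_forall fun x => ?_
    exact Continuous.aestronglyMeasurable (by fun_prop)
  · exact Continuous.intervalIntegrable (by fun_prop) _ _
  · exact Continuous.aestronglyMeasurable (hf'c.comp (by fun_prop : Continuous fun w : ℝ => (p, w)))
  · refine Eventually.of_forall fun t ht x hx => ?_
    exact hC (x, t) ⟨hx, uIoc_subset_uIcc ht⟩
  · simp
  · refine Eventually.of_forall fun t ht x hx => ?_
    have h1 : HasFDerivAt (fun x : ℝ × ℝ => (x, t)) (ContinuousLinearMap.inl ℝ (ℝ × ℝ) ℝ) x :=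
      hasFDerivAt_prodMk_left x t
    exact (hd (x, t)).hasFDerivAt.comp x h1

lemma contDiff_param_nat (a b : ℝ) (n : ℕ) : ∀ (E : Type) [NormedAddCommGroup E] [NormedSpace ℝ E]
    (f : (ℝ × ℝ) × ℝ → E) (_ : ContDiff ℝ n f),
    ContDiff ℝ n (fun p => ∫ w in a..b, f (p, w)) := by
  induction n with
  | zero =>
    intro E _ _ f hf
    rw [Nat.cast_zero, contDiff_zero] at hf ⊢
    exact intervalIntegral.continuous_parametric_intervalIntegral_of_continuous'
      (f := fun p w => f (p, w)) (by exact hf) _ _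
  | succ n ih =>
    intro E _ _ f hf
    have hf' : ContDiff ℝ ((n:WithTop ℕ∞) + 1) f := by exact_mod_cast hf
    have : ContDiff ℝ ((n:WithTop ℕ∞) + 1) (fun p => ∫ w in a..b, f (p, w)) := by
      rw [contDiff_succ_iff_hasFDerivAt]
      refine ⟨fun p => ∫ w in a..b,
        (fderiv ℝ f (p, w)).comp (ContinuousLinearMap.inl ℝ (ℝ × ℝ) ℝ), ?_, ?_⟩
      · refine ih _ (fun z => (fderiv ℝ f z).comp (ContinuousLinearMap.inl ℝ (ℝ × ℝ) ℝ)) ?_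
        exact (hf'.fderiv_right le_rfl).clm_comp contDiff_const
      · exact fun p => hasFDerivAt_param a b f (hf'.of_le (by simp)) p
    exact_mod_cast this

/-- smooth functions of `(τ, x)` -/
def Sm (F : ℝ × ℝ → ℝ) : Prop := ContDiff ℝ (⊤ : ℕ∞) F

def Dt (F : ℝ × ℝ → ℝ) (p : ℝ × ℝ) : ℝ := fderiv ℝ F p (1, 0)
def Dx (F : ℝ × ℝ → ℝ) (p : ℝ × ℝ) : ℝ := fderiv ℝ F p (0, 1)

lemma Sm.diff {F : ℝ × ℝ → ℝ} (h : Sm F) : Differentiable ℝ F :=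
  ContDiff.differentiable h (by simp)

lemma Sm.dv {F : ℝ × ℝ → ℝ} (h : Sm F) (v : ℝ × ℝ) : Sm (fun p => fderiv ℝ F p v) := by
  have : ContDiff ℝ (⊤ : ℕ∞) (fderiv ℝ F) := ContDiff.fderiv_right (n := (⊤ : ℕ∞)) h (by simp)
  exact this.clm_apply contDiff_const

lemma Sm.dt {F : ℝ × ℝ → ℝ} (h : Sm F) : Sm (Dt F) := h.dv _
lemma Sm.dx {F : ℝ × ℝ → ℝ} (h : Sm F) : Sm (Dx F) := h.dv _

lemma Dt_add {F G : ℝ × ℝ → ℝ} (hF : Sm F) (hG : Sm G) :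
    Dt (fun p => F p + G p) = fun p => Dt F p + Dt G p := by
  ext p; simp only [Dt]; rw [fderiv_fun_add (hF.diff p) (hG.diff p)]; rfl
lemma Dx_add {F G : ℝ × ℝ → ℝ} (hF : Sm F) (hG : Sm G) :
    Dx (fun p => F p + G p) = fun p => Dx F p + Dx G p := by
  ext p; simp only [Dx]; rw [fderiv_fun_add (hF.diff p) (hG.diff p)]; rfl
lemma Dt_sub {F G : ℝ × ℝ → ℝ} (hF : Sm F) (hG : Sm G) :
    Dt (fun p => F p - G p) = fun p => Dt F p - Dt G p := by
  ext p; simp only [Dt]; rw [fderiv_fun_sub (hF.diff p) (hG.diff p)]; rfl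
lemma Dx_sub {F G : ℝ × ℝ → ℝ} (hF : Sm F) (hG : Sm G) :
    Dx (fun p => F p - G p) = fun p => Dx F p - Dx G p := by
  ext p; simp only [Dx]; rw [fderiv_fun_sub (hF.diff p) (hG.diff p)]; rfl
lemma Dt_mul {F G : ℝ × ℝ → ℝ} (hF : Sm F) (hG : Sm G) :
    Dt (fun p => F p * G p) = fun p => F p * Dt G p + Dt F p * G p := by
  ext p; simp only [Dt]; rw [fderiv_fun_mul (hF.diff p) (hG.diff p)]
  simp; ring
lemma Dx_mul {F G : ℝ × ℝ → ℝ} (hF : Sm F) (hG : Sm G) :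
    Dx (fun p => F p * G p) = fun p => F p * Dx G p + Dx F p * G p := by
  ext p; simp only [Dx]; rw [fderiv_fun_mul (hF.diff p) (hG.diff p)]
  simp; ring
lemma Dt_smul {F : ℝ × ℝ → ℝ} (c : ℝ) (hF : Sm F) :
    Dt (fun p => c * F p) = fun p => c * Dt F p := by
  ext p; simp only [Dt]; rw [fderiv_const_mul (hF.diff p)]; rfl
lemma Dx_smul {F : ℝ × ℝ → ℝ} (c : ℝ) (hF : Sm F) :
    Dx (fun p => c * F p) = fun p => c * Dx F p := by
  ext p; simp only [Dx]; rw [fderiv_const_mul (hF.diff p)]; rfl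
lemma Dt_const (c : ℝ) : Dt (fun _ => c) = fun _ => 0 := by
  ext p; simp [Dt]
lemma Dx_const (c : ℝ) : Dx (fun _ => c) = fun _ => 0 := by
  ext p; simp [Dx]

lemma Sm_const (c : ℝ) : Sm (fun _ => c) := contDiff_const
lemma Sm.add {F G : ℝ × ℝ → ℝ} (hF : Sm F) (hG : Sm G) : Sm (fun p => F p + G p) :=
  ContDiff.add hF hG
lemma Sm.sub {F G : ℝ × ℝ → ℝ} (hF : Sm F) (hG : Sm G) : Sm (fun p => F p - G p) :=
  ContDiff.sub hF hG
lemma Sm.mul {F G : ℝ × ℝ → ℝ} (hF : Sm F) (hG : Sm G) : Sm (fun p => F p * G p) :=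
  ContDiff.mul hF hG
lemma Sm.smul {F : ℝ × ℝ → ℝ} (c : ℝ) (hF : Sm F) : Sm (fun p => c * F p) :=
  ContDiff.mul contDiff_const hF

/-- composition with shifted map -/
def Sh (ε c : ℝ) (F : ℝ × ℝ → ℝ) (p : ℝ × ℝ) : ℝ := F (p.1, Tr p.1 ε p.2 + c)

/-- trigonometric multipliers -/
def tp (A B C : ℝ) (p : ℝ × ℝ) : ℝ := A + B * Real.cos (2 * π * p.2) + C * Real.sin (2 * π * p.2)

lemma tp_sm (A B C : ℝ) : Sm (tp A B C) := by
  unfold Sm tp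
  fun_prop

lemma tp_hasFDeriv (A B C : ℝ) (p : ℝ × ℝ) : HasFDerivAt (tp A B C)
    ((2 * π * C * Real.cos (2 * π * p.2) - 2 * π * B * Real.sin (2 * π * p.2)) •
      ContinuousLinearMap.snd ℝ ℝ ℝ) p := by
  have h1 : HasFDerivAt (fun p : ℝ × ℝ => 2 * π * p.2) ((2 * π) • ContinuousLinearMap.snd ℝ ℝ ℝ) p :=
    (hasFDerivAt_snd (p := p)).const_mul (2 * π)
  have h2 := ((h1.cos.const_mul B).const_add A).add (h1.sin.const_mul C)
  convert! h2 using 1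
  ext <;> simp <;> ring

lemma Dt_tp (A B C : ℝ) : Dt (tp A B C) = fun _ => 0 := by
  ext p; simp [Dt, (tp_hasFDeriv A B C p).fderiv]
lemma Dx_tp (A B C : ℝ) : Dx (tp A B C) = tp 0 (2 * π * C) (-(2 * π * B)) := by
  ext p; simp [Dx, (tp_hasFDeriv A B C p).fderiv, tp]; ring

lemma tp_bdd (A B C : ℝ) (p : ℝ × ℝ) : |tp A B C p| ≤ |A| + |B| + |C| := by
  unfold tp
  have h1 : |B * Real.cos (2 * π * p.2)| ≤ |B| := by
    rw [abs_mul]; exact mul_le_of_le_one_right (abs_nonneg _) (Real.abs_cos_le_one _)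
  have h2 : |C * Real.sin (2 * π * p.2)| ≤ |C| := by
    rw [abs_mul]; exact mul_le_of_le_one_right (abs_nonneg _) (Real.abs_sin_le_one _)
  have h3 := abs_add_le (A + B * Real.cos (2 * π * p.2)) (C * Real.sin (2 * π * p.2))
  have h4 := abs_add_le A (B * Real.cos (2 * π * p.2))
  linarith

/-- derivative of the map -/
def hp (ε : ℝ) : ℝ × ℝ → ℝ := tp 1 (-(2 * π * ε)) 0

lemma Trp_eq (ε c : ℝ) (p : ℝ × ℝ) : Tr p.1 ε p.2 + c = p.1 + p.2 + tp c 0 (-ε) p := by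
  simp [Tr, tp]; ring

lemma Trp_hasFDeriv (ε c : ℝ) (p : ℝ × ℝ) : HasFDerivAt (fun p : ℝ × ℝ => Tr p.1 ε p.2 + c)
    (ContinuousLinearMap.fst ℝ ℝ ℝ + hp ε p • ContinuousLinearMap.snd ℝ ℝ ℝ) p := by
  have h := (hasFDerivAt_fst (𝕜 := ℝ) (p := p)).add (hasFDerivAt_snd (𝕜 := ℝ) (p := p)) |>.add (tp_hasFDeriv c 0 (-ε) p)
  have e : (fun p : ℝ × ℝ => Tr p.1 ε p.2 + c) = fun p => p.1 + p.2 + tp c 0 (-ε) p := by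
    ext p; exact Trp_eq ε c p
  rw [e]
  convert! h using 1
  ext <;> simp [hp, tp]

lemma Sm.sh {F : ℝ × ℝ → ℝ} (h : Sm F) (ε c : ℝ) : Sm (Sh ε c F) := by
  unfold Sm Sh
  refine ContDiff.comp (g := F) h ?_
  simp only [Trp_eq]
  have := tp_sm c 0 (-ε)
  unfold Sm at this
  fun_prop

lemma Sh_fderiv {F : ℝ × ℝ → ℝ} (h : Sm F) (ε c : ℝ) (p v : ℝ × ℝ) :
    fderiv ℝ (Sh ε c F) p v = v.1 * Sh ε c (Dt F) p + (v.1 + hp ε p * v.2) * Sh ε c (Dx F) p := by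
  have h1 : HasFDerivAt (fun p : ℝ × ℝ => (p.1, Tr p.1 ε p.2 + c)) _ p :=
    (hasFDerivAt_fst (𝕜 := ℝ) (p := p)).prodMk (Trp_hasFDeriv ε c p)
  have h2 := (h.diff (p.1, Tr p.1 ε p.2 + c)).hasFDerivAt.comp p h1
  have h3 : fderiv ℝ (Sh ε c F) p = _ := h2.fderiv
  rw [h3]
  simp only [ContinuousLinearMap.comp_apply, Sh, Dt, Dx]
  have h4 : ((ContinuousLinearMap.fst ℝ ℝ ℝ).prod
      (ContinuousLinearMap.fst ℝ ℝ ℝ + hp ε p • ContinuousLinearMap.snd ℝ ℝ ℝ)) v =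
      v.1 • ((1:ℝ), (0:ℝ)) + (v.1 + hp ε p * v.2) • ((0:ℝ), (1:ℝ)) := by
    ext <;> simp
  rw [h4, map_add, map_smul, map_smul]
  rfl

lemma Dt_sh {F : ℝ × ℝ → ℝ} (h : Sm F) (ε c : ℝ) :
    Dt (Sh ε c F) = fun p => Sh ε c (Dt F) p + Sh ε c (Dx F) p := by
  ext p; rw [Dt, Sh_fderiv h]; simp
lemma Dx_sh {F : ℝ × ℝ → ℝ} (h : Sm F) (ε c : ℝ) :
    Dx (Sh ε c F) = fun p => hp ε p * Sh ε c (Dx F) p := by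
  ext p; rw [Dx, Sh_fderiv h]; simp

/-- the averaging operator on functions of `(τ, x)` -/
def PP (ε σ : ℝ) (F : ℝ × ℝ → ℝ) (p : ℝ × ℝ) : ℝ :=
  ∫ w in (-(1/2) : ℝ)..(1/2), Sh ε (σ * w) F p

def DD (ε σ : ℝ) (F : ℝ × ℝ → ℝ) (p : ℝ × ℝ) : ℝ := Sh ε (σ / 2) F p - Sh ε (-(σ / 2)) F p

lemma PP_eq_Pop (ε σ τ x : ℝ) (F : ℝ × ℝ → ℝ) :
    PP ε σ F (τ, x) = Pop τ ε σ (fun y => F (τ, y)) x := rfl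

lemma kern_sm {F : ℝ × ℝ → ℝ} (h : Sm F) (ε σ : ℝ) :
    ContDiff ℝ (⊤ : ℕ∞) (fun z : (ℝ × ℝ) × ℝ => Sh ε (σ * z.2) F z.1) := by
  unfold Sh
  refine ContDiff.comp (g := F) h ?_
  unfold Tr
  fun_prop

lemma Sm.pp {F : ℝ × ℝ → ℝ} (h : Sm F) (ε σ : ℝ) : Sm (PP ε σ F) := by
  unfold Sm
  rw [contDiff_infty]
  intro n
  exact contDiff_param_nat _ _ n ℝ (fun z : (ℝ × ℝ) × ℝ => Sh ε (σ * z.2) F z.1)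
    ((kern_sm h ε σ).of_le (by exact_mod_cast le_top))

lemma Sm.dd {F : ℝ × ℝ → ℝ} (h : Sm F) (ε σ : ℝ) : Sm (DD ε σ F) := (h.sh _ _).sub (h.sh _ _)

lemma PP_fderiv {F : ℝ × ℝ → ℝ} (h : Sm F) (ε σ : ℝ) (p v : ℝ × ℝ) :
    fderiv ℝ (PP ε σ F) p v = ∫ w in (-(1/2) : ℝ)..(1/2), fderiv ℝ (Sh ε (σ * w) F) p v := by
  have hk := (kern_sm h ε σ).of_le (show (1 : WithTop ℕ∞) ≤ ((⊤ : ℕ∞) : WithTop ℕ∞) by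
    exact_mod_cast le_top)
  have h1 := hasFDerivAt_param (-(1/2)) (1/2) _ hk p
  have h2 : fderiv ℝ (PP ε σ F) p = _ := h1.fderiv
  rw [h2, ContinuousLinearMap.intervalIntegral_apply]
  · refine intervalIntegral.integral_congr fun w _ => ?_
    have h3 : HasFDerivAt (fun x : ℝ × ℝ => (x, w)) (ContinuousLinearMap.inl ℝ (ℝ × ℝ) ℝ) p :=
      hasFDerivAt_prodMk_left p w
    have h4 := ((hk.differentiable one_ne_zero) (p, w)).hasFDerivAt.comp p h3
    have h5 : fderiv ℝ (Sh ε (σ * w) F) p = _ := h4.fderiv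
    exact (congrArg (fun L => L v) h5).symm
  · apply Continuous.intervalIntegrable
    have hf'c : Continuous fun z => (fderiv ℝ (fun z : (ℝ × ℝ) × ℝ => Sh ε (σ * z.2) F z.1) z).comp
        (ContinuousLinearMap.inl ℝ (ℝ × ℝ) ℝ) :=
      (hk.continuous_fderiv one_ne_zero).clm_comp continuous_const
    exact hf'c.comp (by fun_prop : Continuous fun w : ℝ => (p, w))

lemma PP_dx {F : ℝ × ℝ → ℝ} (h : Sm F) (ε σ : ℝ) (hσ : 0 < σ) (p : ℝ × ℝ) :
    PP ε σ (Dx F) p = σ⁻¹ * DD ε σ F p := by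
  unfold PP DD Sh
  rw [intervalIntegral.integral_comp_add_mul (fun y => Dx F (p.1, y)) hσ.ne', smul_eq_mul]
  congr 1
  rw [intervalIntegral.integral_eq_sub_of_hasDerivAt (f := fun y => F (p.1, y))]
  · congr 3 <;> ring
  · intro y _
    have h3 : HasFDerivAt (fun x : ℝ => (p.1, x)) (ContinuousLinearMap.inr ℝ ℝ ℝ) y :=
      hasFDerivAt_prodMk_right p.1 y
    have h4 := (h.diff (p.1, y)).hasFDerivAt.comp y h3
    have : HasDerivAt (fun y => F (p.1, y)) _ y := h4.hasDerivAt
    convert! this using 1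
  · apply Continuous.intervalIntegrable
    have := ContDiff.continuous h.dx
    fun_prop

lemma sh_ii {F : ℝ × ℝ → ℝ} (h : Sm F) (ε σ : ℝ) (p : ℝ × ℝ) (a b : ℝ) :
    IntervalIntegrable (fun w => Sh ε (σ * w) F p) volume a b := by
  apply Continuous.intervalIntegrable
  have := ContDiff.continuous h
  unfold Sh
  fun_prop

lemma Dt_pp {F : ℝ × ℝ → ℝ} (h : Sm F) (ε σ : ℝ) (hσ : 0 < σ) :
    Dt (PP ε σ F) = fun p => PP ε σ (Dt F) p + σ⁻¹ * DD ε σ F p := by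
  ext p
  rw [Dt, PP_fderiv h, ← PP_dx h ε σ hσ]
  simp only [Sh_fderiv h]
  simp only [one_mul, mul_zero, add_zero]
  exact intervalIntegral.integral_add (sh_ii h.dt ε σ p _ _) (sh_ii h.dx ε σ p _ _)

lemma Dx_pp {F : ℝ × ℝ → ℝ} (h : Sm F) (ε σ : ℝ) (hσ : 0 < σ) :
    Dx (PP ε σ F) = fun p => hp ε p * (σ⁻¹ * DD ε σ F p) := by
  ext p
  rw [Dx, PP_fderiv h, ← PP_dx h ε σ hσ]
  simp only [Sh_fderiv h]
  simp only [zero_mul, zero_add, mul_one]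
  exact intervalIntegral.integral_const_mul _ _

lemma Dt_dd {F : ℝ × ℝ → ℝ} (h : Sm F) (ε σ : ℝ) :
    Dt (DD ε σ F) = fun p => DD ε σ (Dt F) p + DD ε σ (Dx F) p := by
  unfold DD
  rw [Dt_sub (h.sh _ _) (h.sh _ _), Dt_sh h, Dt_sh h]
  ext p; ring

lemma Dx_dd {F : ℝ × ℝ → ℝ} (h : Sm F) (ε σ : ℝ) :
    Dx (DD ε σ F) = fun p => hp ε p * DD ε σ (Dx F) p := by
  unfold DD
  rw [Dx_sub (h.sh _ _) (h.sh _ _), Dx_sh h, Dx_sh h]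
  ext p; ring

def Sc0 (E : ℕ → ℝ × ℝ → ℝ) : Prop :=
  (∀ n, Sm (E n)) ∧ ∃ C q : ℝ, 0 ≤ C ∧ 0 < q ∧ q < 1 ∧ ∀ n p, |E n p| ≤ C * q ^ n

def Oc0 (E : ℕ → ℝ × ℝ → ℝ) : Prop :=
  (∀ n, Sm (E n)) ∧ ∃ C q : ℝ, 0 ≤ C ∧ 0 < q ∧ q < 1 ∧
    ∀ n τ x y, |E n (τ, x) - E n (τ, y)| ≤ C * q ^ n

def Sc : ℕ → (ℕ → ℝ × ℝ → ℝ) → Prop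
  | 0, E => Sc0 E
  | m + 1, E => Sc0 E ∧ Sc m (fun n => Dt (E n)) ∧ Sc m (fun n => Dx (E n))

def Oc : ℕ → (ℕ → ℝ × ℝ → ℝ) → Prop
  | 0, E => Oc0 E
  | m + 1, E => Oc0 E ∧ Oc m (fun n => Dt (E n)) ∧ Oc m (fun n => Dx (E n))

lemma Sc.z {m : ℕ} {E : ℕ → ℝ × ℝ → ℝ} (h : Sc m E) : Sc0 E := by
  cases m with
  | zero => exact h
  | succ m => exact h.1

lemma Oc.z {m : ℕ} {E : ℕ → ℝ × ℝ → ℝ} (h : Oc m E) : Oc0 E := by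
  cases m with
  | zero => exact h
  | succ m => exact h.1

lemma Sc.sm {m : ℕ} {E : ℕ → ℝ × ℝ → ℝ} (h : Sc m E) (n : ℕ) : Sm (E n) := h.z.1 n
lemma Oc.sm {m : ℕ} {E : ℕ → ℝ × ℝ → ℝ} (h : Oc m E) (n : ℕ) : Sm (E n) := h.z.1 n

lemma ed_add {C q C' q' : ℝ} (hC : 0 ≤ C) (hq : 0 < q) (hC' : 0 ≤ C') (hq' : 0 < q') (n : ℕ) :
    C * q ^ n + C' * q' ^ n ≤ (C + C') * (max q q') ^ n := by
  have h1 : q ^ n ≤ (max q q') ^ n := pow_le_pow_left₀ hq.le (le_max_left _ _) n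
  have h2 : q' ^ n ≤ (max q q') ^ n := pow_le_pow_left₀ hq'.le (le_max_right _ _) n
  nlinarith [mul_le_mul_of_nonneg_left h1 hC, mul_le_mul_of_nonneg_left h2 hC']

lemma Sc.add {m : ℕ} : ∀ {E G : ℕ → ℝ × ℝ → ℝ}, Sc m E → Sc m G →
    Sc m (fun n p => E n p + G n p) := by
  have key : ∀ {E G : ℕ → ℝ × ℝ → ℝ}, Sc0 E → Sc0 G → Sc0 (fun n p => E n p + G n p) := by
    rintro E G ⟨sE, C, q, hC, hq, hq1, hE⟩ ⟨sG, C', q', hC', hq', hq1', hG⟩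
    refine ⟨fun n => (sE n).add (sG n), C + C', max q q', by positivity, lt_max_of_lt_left hq,
      max_lt hq1 hq1', fun n p => ?_⟩
    exact ((abs_add_le _ _).trans (add_le_add (hE n p) (hG n p))).trans (ed_add hC hq hC' hq' n)
  induction m with
  | zero => exact key
  | succ m ih =>
    intro E G hE hG
    refine ⟨key hE.z hG.z, ?_, ?_⟩
    · simp_rw [fun n => Dt_add (hE.sm n) (hG.sm n)]; exact ih hE.2.1 hG.2.1
    · simp_rw [fun n => Dx_add (hE.sm n) (hG.sm n)]; exact ih hE.2.2 hG.2.2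

lemma Sc.smul {m : ℕ} (c : ℝ) : ∀ {E : ℕ → ℝ × ℝ → ℝ}, Sc m E → Sc m (fun n p => c * E n p) := by
  have key : ∀ {E : ℕ → ℝ × ℝ → ℝ}, Sc0 E → Sc0 (fun n p => c * E n p) := by
    rintro E ⟨sE, C, q, hC, hq, hq1, hE⟩
    refine ⟨fun n => (sE n).smul c, |c| * C, q, by positivity, hq, hq1, fun n p => ?_⟩
    rw [abs_mul, mul_assoc]
    exact mul_le_mul_of_nonneg_left (hE n p) (abs_nonneg _)
  induction m with
  | zero => exact key
  | succ m ih =>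
    intro E hE
    refine ⟨key hE.z, ?_, ?_⟩
    · simp_rw [fun n => Dt_smul c (hE.sm n)]; exact ih hE.2.1
    · simp_rw [fun n => Dx_smul c (hE.sm n)]; exact ih hE.2.2

lemma Sc.lower {m : ℕ} : ∀ {E : ℕ → ℝ × ℝ → ℝ}, Sc (m + 1) E → Sc m E := by
  induction m with
  | zero => exact fun h => h.z
  | succ m ih => exact fun h => ⟨h.z, ih h.2.1, ih h.2.2⟩

lemma Oc.lower {m : ℕ} : ∀ {E : ℕ → ℝ × ℝ → ℝ}, Oc (m + 1) E → Oc m E := by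
  induction m with
  | zero => exact fun h => h.z
  | succ m ih => exact fun h => ⟨h.z, ih h.2.1, ih h.2.2⟩

lemma Sc.tpm {m : ℕ} : ∀ (A B D : ℝ) {E : ℕ → ℝ × ℝ → ℝ}, Sc m E →
    Sc m (fun n p => tp A B D p * E n p) := by
  have key : ∀ (A B D : ℝ) {E : ℕ → ℝ × ℝ → ℝ}, Sc0 E → Sc0 (fun n p => tp A B D p * E n p) := by
    rintro A B D E ⟨sE, C, q, hC, hq, hq1, hE⟩
    refine ⟨fun n => (tp_sm A B D).mul (sE n), (|A| + |B| + |D|) * C, q, by positivity, hq, hq1,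
      fun n p => ?_⟩
    rw [abs_mul, mul_assoc]
    exact mul_le_mul (tp_bdd A B D p) (hE n p) (abs_nonneg _) (by positivity)
  induction m with
  | zero => exact key
  | succ m ih =>
    intro A B D E hE
    refine ⟨key A B D hE.z, ?_, ?_⟩
    · simp_rw [fun n => Dt_mul (tp_sm A B D) (hE.sm n), Dt_tp]
      simpa using ih A B D hE.2.1
    · simp_rw [fun n => Dx_mul (tp_sm A B D) (hE.sm n), Dx_tp]
      exact (ih A B D hE.2.2).add (ih _ _ _ hE.lower)

lemma Sc.oc {m : ℕ} : ∀ {E : ℕ → ℝ × ℝ → ℝ}, Sc m E → Oc m E := by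
  have key : ∀ {E : ℕ → ℝ × ℝ → ℝ}, Sc0 E → Oc0 E := by
    rintro E ⟨sE, C, q, hC, hq, hq1, hE⟩
    refine ⟨sE, 2 * C, q, by positivity, hq, hq1, fun n τ x y => ?_⟩
    have := abs_sub (E n (τ, x)) (E n (τ, y))
    have h1 := hE n (τ, x)
    have h2 := hE n (τ, y)
    linarith
  induction m with
  | zero => exact key
  | succ m ih => exact fun h => ⟨key h.z, ih h.2.1, ih h.2.2⟩

lemma Oc.dd (ε σ : ℝ) {m : ℕ} : ∀ {F : ℕ → ℝ × ℝ → ℝ}, Oc m F → Sc m (fun n => DD ε σ (F n)) := by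
  have key : ∀ {E : ℕ → ℝ × ℝ → ℝ}, Oc0 E → Sc0 (fun n => DD ε σ (E n)) := by
    rintro E ⟨sE, C, q, hC, hq, hq1, hE⟩
    exact ⟨fun n => (sE n).dd ε σ, C, q, hC, hq, hq1, fun n p => hE n _ _ _⟩
  induction m with
  | zero => exact key
  | succ m ih =>
    intro F h
    refine ⟨key h.z, ?_, ?_⟩
    · simp_rw [fun n => Dt_dd (h.sm n) ε σ]
      exact (ih h.2.1).add (ih h.2.2)
    · simp_rw [fun n => Dx_dd (h.sm n) ε σ]
      exact (ih h.2.2).tpm _ _ _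

lemma scal {ρ C q : ℝ} (hρ : 0 < ρ) (hρ1 : ρ < 1) (hC : 0 ≤ C) (hq : 0 < q) (hq1 : q < 1) :
    ∃ B r : ℝ, 0 ≤ B ∧ 0 < r ∧ r < 1 ∧ ∀ n : ℕ, ρ * (B * r ^ n) + C * q ^ n ≤ B * r ^ (n + 1) := by
  set r := (max ρ q + 1) / 2
  have h1 : max ρ q < 1 := max_lt hρ1 hq1
  have h2 := le_max_left ρ q
  have h3 := le_max_right ρ q
  have hr : ρ < r := by simp only [r]; linarith
  have hr2 : q < r := by simp only [r]; linarith
  refine ⟨C / (r - ρ), r, div_nonneg hC (by linarith), hρ.trans hr, by simp only [r]; linarith,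
    fun n => ?_⟩
  have h4 : q ^ n ≤ r ^ n := pow_le_pow_left₀ hq.le hr2.le n
  have h5 : C / (r - ρ) * r ^ (n + 1) = ρ * (C / (r - ρ) * r ^ n) + C * r ^ n := by
    have : r - ρ ≠ 0 := by linarith
    field_simp
    ring
  rw [h5]
  gcongr

lemma Sc.half {m : ℕ} : ∀ {a E : ℕ → ℝ × ℝ → ℝ}, (∀ n, Sm (a n)) → (a 0 = fun _ => 0) →
    (∀ n, a (n + 1) = fun p => (1/2) * a n p + E n p) → Sc m E → Sc m a := by
  have key : ∀ {a E : ℕ → ℝ × ℝ → ℝ}, (∀ n, Sm (a n)) → (a 0 = fun _ => 0) →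
    (∀ n, a (n + 1) = fun p => (1/2) * a n p + E n p) → Sc0 E → Sc0 a := by
    rintro a E sa a0 ha ⟨sE, C, q, hC, hq, hq1, hE⟩
    obtain ⟨B, r, hB, hr, hr1, H⟩ := scal (ρ := 1/2) (by norm_num) (by norm_num) hC hq hq1
    refine ⟨sa, B, r, hB, hr, hr1, fun n => ?_⟩
    induction n with
    | zero => intro p; simp [a0, hB]
    | succ n ih =>
      intro p
      rw [ha]
      refine (abs_add_le _ _).trans (le_trans ?_ (H n))
      rw [abs_mul, abs_of_pos (by norm_num : (0:ℝ) < 1/2)]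
      have := ih p
      have := hE n p
      linarith
  induction m with
  | zero => exact key
  | succ m ih =>
    intro a E sa a0 ha hE
    refine ⟨key sa a0 ha hE.z, ih (fun n => (sa n).dt) ?_ ?_ hE.2.1,
      ih (fun n => (sa n).dx) ?_ ?_ hE.2.2⟩
    · simp only [a0, Dt_const]
    · intro n; simp only [ha]; rw [Dt_add ((sa n).smul _) (hE.sm n), Dt_smul _ (sa n)]
    · simp only [a0, Dx_const]
    · intro n; simp only [ha]; rw [Dx_add ((sa n).smul _) (hE.sm n), Dx_smul _ (sa n)]

def Px (F : ℝ × ℝ → ℝ) : Prop := ∀ p : ℝ × ℝ, F (p + (0, 1)) = F p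

lemma Px.per {F : ℝ × ℝ → ℝ} (h : Px F) (τ : ℝ) : Periodic (fun y => F (τ, y)) 1 := by
  intro y
  have := h (τ, y)
  simpa using this

lemma Px.dt {F : ℝ × ℝ → ℝ} (h : Px F) : Px (Dt F) := by
  intro p
  have e : (fun p => F (p + (0, 1))) = F := funext h
  have := fderiv_comp_add_right (𝕜 := ℝ) (f := F) (x := p) (0, 1)
  rw [e] at this
  simp only [Dt, ← this]

lemma Px.sh {F : ℝ × ℝ → ℝ} (h : Px F) (ε c : ℝ) : Px (Sh ε c F) := by
  intro p
  have e : Tr p.1 ε (p.2 + 1) = Tr p.1 ε p.2 + 1 := by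
    have := Tr_add_int p.1 ε p.2 1
    simpa using this
  have := h (p.1, Tr p.1 ε p.2 + c)
  simp only [Sh, Prod.fst_add, Prod.snd_add, add_zero, e]
  rw [← this]
  congr 1
  ext <;> simp; ring

lemma Px.dd {F : ℝ × ℝ → ℝ} (h : Px F) (ε σ : ℝ) : Px (DD ε σ F) := by
  intro p; simp only [DD, h.sh ε _ p]

lemma Px.pp {F : ℝ × ℝ → ℝ} (h : Px F) (ε σ : ℝ) : Px (PP ε σ F) := by
  intro p; simp only [PP, h.sh ε _ p]

/-- the recursion -/
structure Rec (ε σ : ℝ) (F E : ℕ → ℝ × ℝ → ℝ) : Prop where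
  sF : ∀ n, Sm (F n)
  pE : ∀ n, Px (E n)
  F0 : F 0 = fun _ => 0
  st : ∀ n, F (n + 1) = fun p => (1/2) * F n p + ((1/2) * PP ε σ (F n) p + E n p)

lemma Rec.pF {ε σ : ℝ} {F E : ℕ → ℝ × ℝ → ℝ} (h : Rec ε σ F E) (n : ℕ) : Px (F n) := by
  induction n with
  | zero => rw [h.F0]; intro p; rfl
  | succ n ih =>
    rw [h.st]; intro p; simp only [ih p, ih.pp ε σ p, h.pE n p]

lemma Rec.dt {ε σ : ℝ} (hσ : 0 < σ) {F E : ℕ → ℝ × ℝ → ℝ} (h : Rec ε σ F E) (sE : ∀ n, Sm (E n)) :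
    Rec ε σ (fun n => Dt (F n)) (fun n p => (1/2) * (σ⁻¹ * DD ε σ (F n) p) + Dt (E n) p) := by
  refine ⟨fun n => (h.sF n).dt, fun n p => ?_, ?_, fun n => ?_⟩
  · simp only [(h.pF n).dd ε σ p, (h.pE n).dt p]
  · simp only [h.F0, Dt_const]
  · simp only [h.st]
    rw [Dt_add ((h.sF n).smul _) ((((h.sF n).pp ε σ).smul _).add (sE n)), Dt_smul _ (h.sF n),
      Dt_add (((h.sF n).pp ε σ).smul _) (sE n), Dt_smul _ ((h.sF n).pp ε σ), Dt_pp (h.sF n) ε σ hσ]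
    ext p; ring

lemma Rec.dxst {ε σ : ℝ} (hσ : 0 < σ) {F E : ℕ → ℝ × ℝ → ℝ} (h : Rec ε σ F E) (sE : ∀ n, Sm (E n))
    (n : ℕ) : Dx (F (n + 1)) =
      fun p => (1/2) * Dx (F n) p + ((1/2) * (hp ε p * (σ⁻¹ * DD ε σ (F n) p)) + Dx (E n) p) := by
  rw [h.st, Dx_add ((h.sF n).smul _) ((((h.sF n).pp ε σ).smul _).add (sE n)), Dx_smul _ (h.sF n),
      Dx_add (((h.sF n).pp ε σ).smul _) (sE n), Dx_smul _ ((h.sF n).pp ε σ), Dx_pp (h.sF n) ε σ hσ]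

lemma Rec.base {ε σ : ℝ} (hε : 0 < ε) (hεπ : 2 * π * ε < 1) (hσ : 0 < σ)
    {F E : ℕ → ℝ × ℝ → ℝ} (h : Rec ε σ F E) (hE : Sc0 E) : Oc0 F := by
  obtain ⟨K, ρ, hK, hρ, hρ1, H⟩ := expo_contr ε σ hε hεπ hσ
  obtain ⟨sE, C, q, hC, hq, hq1, hEb⟩ := hE
  obtain ⟨B, r, hB, hr, hr1, HB⟩ := scal hρ hρ1 (C := K * (2 * C)) (by positivity) hq hq1
  have cF : ∀ n τ, Continuous (fun y => F n (τ, y)) := fun n τ => by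
    have := ContDiff.continuous (h.sF n)
    fun_prop
  have cE : ∀ n τ, Continuous (fun y => E n (τ, y)) := fun n τ => by
    have := ContDiff.continuous (sE n)
    fun_prop
  have main : ∀ n τ k x y, (Qop τ ε σ)^[k] (fun z => F n (τ, z)) x -
      (Qop τ ε σ)^[k] (fun z => F n (τ, z)) y ≤ B * r ^ n * ρ ^ k := by
    intro n
    induction n with
    | zero =>
      intro τ k x y
      simp only [h.F0, Qop_iter_const]
      simp; positivity
    | succ n ih =>
      intro τ k x y
      have e : (fun z => F (n + 1) (τ, z)) = fun z => 1 * Qop τ ε σ (fun z => F n (τ, z)) z +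
          1 * E n (τ, z) := by
        ext z; rw [h.st]; simp only [PP_eq_Pop, Qop]; ring
      rw [e, Qop_iter_lin τ ε σ _ _ k _ _ (Qop_cont _ _ _ _ (cF n τ)) (cE n τ)]
      simp only [← iterate_succ_apply]
      have h1 := ih τ (k + 1) x y
      have h2 := H τ (fun y => E n (τ, y)) (2 * (C * q ^ n)) (cE n τ) ((h.pE n).per τ)
        (by positivity) (fun x y => by
          have h1 := abs_le.1 (hEb n (τ, x))
          have h2 := abs_le.1 (hEb n (τ, y))
          linarith) k x y
      have h3 := mul_le_mul_of_nonneg_right (HB n) (pow_nonneg hρ.le k)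
      calc _ ≤ B * r ^ n * ρ ^ (k + 1) + K * (2 * (C * q ^ n)) * ρ ^ k := by linarith
        _ = (ρ * (B * r ^ n) + K * (2 * C) * q ^ n) * ρ ^ k := by ring
        _ ≤ _ := h3
  refine ⟨h.sF, B, r, hB, hr, hr1, fun n τ x y => ?_⟩
  have h1 := main n τ 0 x y
  have h2 := main n τ 0 y x
  simp only [iterate_zero, id, pow_zero, mul_one] at h1 h2
  rw [abs_le]; constructor <;> linarith

lemma PP_sub_le {ε σ C : ℝ} {F : ℝ × ℝ → ℝ} (sF : Sm F) (τ : ℝ)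
    (h : ∀ x y, |F (τ, x) - F (τ, y)| ≤ C) (x : ℝ) : |PP ε σ F (τ, x) - F (τ, x)| ≤ C := by
  have e : PP ε σ F (τ, x) - F (τ, x) =
      ∫ w in (-(1/2) : ℝ)..(1/2), (Sh ε (σ * w) F (τ, x) - F (τ, x)) := by
    rw [intervalIntegral.integral_sub (sh_ii sF ε σ _ _ _) (by simp)]
    simp [PP]; norm_num
  rw [e]
  have := intervalIntegral.norm_integral_le_of_norm_le_const (a := (-(1/2):ℝ)) (b := 1/2) (C := C)
    (f := fun w => Sh ε (σ * w) F (τ, x) - F (τ, x)) (fun w _ => h _ _)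
  norm_num at this ⊢
  exact this

lemma Rec.main {ε σ : ℝ} (hε : 0 < ε) (hεπ : 2 * π * ε < 1) (hσ : 0 < σ) (m : ℕ) :
    ∀ {F E : ℕ → ℝ × ℝ → ℝ}, Rec ε σ F E → Sc m E → Oc m F ∧ ∃ C q : ℝ, 0 ≤ C ∧ 0 < q ∧ q < 1 ∧
      ∀ n p, |Dt^[m] (F (n + 1)) p - Dt^[m] (F n) p| ≤ C * q ^ n := by
  induction m with
  | zero =>
    intro F E h hE
    have hO := h.base hε hεπ hσ hE
    refine ⟨hO, ?_⟩
    obtain ⟨_, C, q, hC, hq, hq1, hE⟩ := hE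
    obtain ⟨_, C', q', hC', hq', hq1', hF⟩ := hO
    refine ⟨C + C', max q q', by positivity, lt_max_of_lt_left hq, max_lt hq1 hq1', ?_⟩
    rintro n ⟨τ, x⟩
    simp only [iterate_zero, id, h.st]
    have h1 := PP_sub_le (ε := ε) (σ := σ) (h.sF n) τ (hF n τ) x
    have h2 := abs_le.1 h1
    have h3 := abs_le.1 (hE n (τ, x))
    refine le_trans ?_ (ed_add hC hq hC' hq' n)
    have : 0 ≤ C' * q' ^ n := by positivity
    rw [abs_le]; constructor <;> linarith
  | succ m ih =>
    intro F E h hE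
    have hO := h.base hε hεπ hσ hE.z
    have hF := (ih h hE.lower).1
    have sE := fun n => hE.sm n
    have hD := hF.dd ε σ
    obtain ⟨i1, i2⟩ := ih (h.dt hσ sE) (((hD.smul σ⁻¹).smul (1/2)).add hE.2.1)
    refine ⟨⟨hO, i1, Sc.oc ?_⟩, i2⟩
    refine Sc.half (fun n => (h.sF n).dx) (by simp only [h.F0, Dx_const]) (h.dxst hσ sE) ?_
    exact (((hD.smul σ⁻¹).tpm _ _ _).smul (1/2)).add hE.2.2

lemma Sc_const {m : ℕ} : ∀ {c : ℕ → ℝ} {C q : ℝ}, 0 ≤ C → 0 < q → q < 1 → (∀ n, |c n| ≤ C * q ^ n) →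
    Sc m (fun n _ => c n) := by
  have key : ∀ {c : ℕ → ℝ} {C q : ℝ}, 0 ≤ C → 0 < q → q < 1 → (∀ n, |c n| ≤ C * q ^ n) →
    Sc0 (fun n _ => c n) := fun {c C q} hC hq hq1 h =>
      ⟨fun n => Sm_const _, C, q, hC, hq, hq1, fun n _ => h n⟩
  induction m with
  | zero => exact key
  | succ m ih =>
    intro c C q hC hq hq1 h
    refine ⟨key hC hq hq1 h, ?_, ?_⟩
    · simp_rw [Dt_const]
      exact ih (c := fun _ => 0) hC hq hq1 (fun n => by simp; positivity)
    · simp_rw [Dx_const]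
      exact ih (c := fun _ => 0) hC hq hq1 (fun n => by simp; positivity)

def Es (ε : ℝ) (n : ℕ) (p : ℝ × ℝ) : ℝ := tp 0 0 (-ε) p * (if n = 0 then 1 else 0)

def Fs (ε σ : ℝ) : ℕ → ℝ × ℝ → ℝ
  | 0 => fun _ => 0
  | n + 1 => fun p => (1/2) * Fs ε σ n p + ((1/2) * PP ε σ (Fs ε σ n) p + Es ε n p)

lemma Es_sc (ε : ℝ) (m : ℕ) : Sc m (Es ε) := by
  refine Sc.tpm (E := fun n _ => if n = 0 then 1 else 0) 0 0 (-ε) ?_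
  refine Sc_const (c := fun n => if n = 0 then 1 else 0) zero_le_one (q := 1/2) (by norm_num)
    (by norm_num) fun n => ?_
  by_cases h : n = 0
  · simp [h]
  · simp [h]

lemma Fs_rec (ε σ : ℝ) : Rec ε σ (Fs ε σ) (Es ε) := by
  refine ⟨fun n => ?_, fun n p => ?_, rfl, fun n => rfl⟩
  · induction n with
    | zero => exact Sm_const 0
    | succ n ih => exact (ih.smul _).add (((ih.pp ε σ).smul _).add ((Es_sc ε 0).sm n))
  · have : 2 * π * (p.2 + 1) = 2 * π * p.2 + 2 * π := by ring
    simp [Es, tp, this]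

lemma Fs_eq (ε σ τ : ℝ) (n : ℕ) : (fun x => Fs ε σ (n + 1) (τ, x)) =
    (Qop τ ε σ)^[n] (fun x => -ε * Real.sin (2 * π * x)) := by
  induction n with
  | zero =>
    ext x
    simp [Fs, Es, tp, PP, Sh]
  | succ n ih =>
    rw [iterate_succ_apply', ← ih]
    ext x
    rw [Fs]
    simp only [PP_eq_Pop, Qop, Es]
    simp
    ring

lemma Dt_iter_sm (m : ℕ) : ∀ {F : ℝ × ℝ → ℝ}, Sm F → Sm (Dt^[m] F) := by
  induction m with
  | zero => exact fun h => h
  | succ m ih => exact fun h => ih h.dt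

lemma iter_Dt (m : ℕ) : ∀ {F : ℝ × ℝ → ℝ}, Sm F → ∀ x,
    iteratedDeriv m (fun τ => F (τ, x)) = fun τ => Dt^[m] F (τ, x) := by
  induction m with
  | zero => intro F h x; simp
  | succ m ih =>
    intro F h x
    rw [iteratedDeriv_succ', iterate_succ_apply, ← ih h.dt x]
    congr 1
    ext τ
    have h3 : HasFDerivAt (fun t : ℝ => (t, x)) (ContinuousLinearMap.inl ℝ ℝ ℝ) τ :=
      hasFDerivAt_prodMk_left τ x
    have h4 := (h.diff (τ, x)).hasFDerivAt.comp τ h3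
    have : HasDerivAt (fun t => F (t, x)) _ τ := h4.hasDerivAt
    rw [this.deriv]
    rfl

lemma Dt_iter_sub (m : ℕ) : ∀ {F G : ℝ × ℝ → ℝ}, Sm F → Sm G →
    Dt^[m] (fun p => F p - G p) = fun p => Dt^[m] F p - Dt^[m] G p := by
  induction m with
  | zero => intro F G _ _; rfl
  | succ m ih =>
    intro F G hF hG
    simp only [iterate_succ_apply]
    rw [Dt_sub hF hG, ih hF.dt hG.dt]

lemma corr (ε σ : ℝ) (hε : 0 < ε) (hεπ : 2 * π * ε < 1) (hσ : 0 < σ) :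
    ∃ c : ℝ → ℝ, ContDiff ℝ (⊤ : ℕ∞) c ∧ ∀ τ δ, 0 < δ → ∃ N, ∀ x,
      |(Qop τ ε σ)^[N] (fun x => -ε * Real.sin (2 * π * x)) x - c τ| ≤ δ := by
  have hM := fun m => Rec.main hε hεπ hσ m (Fs_rec ε σ) (Es_sc ε m)
  choose hO C q hC hq hq1 hb using hM
  have sF := (Fs_rec ε σ).sF
  have hsum : ∀ k, Summable fun n => C k * q k ^ n := fun k =>
    (summable_geometric_of_lt_one (hq k).le (hq1 k)).mul_left _
  refine ⟨fun τ => ∑' n, (Fs ε σ (n + 1) (τ, 0) - Fs ε σ n (τ, 0)), ?_, ?_⟩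
  · refine contDiff_tsum (v := fun k n => C k * q k ^ n) (fun n => ?_) (fun k _ => hsum k) ?_
    · have := (sF (n + 1)).sub (sF n)
      unfold Sm at this
      exact ContDiff.comp (g := fun p => Fs ε σ (n + 1) p - Fs ε σ n p) this
        (f := fun τ : ℝ => (τ, (0:ℝ))) (by fun_prop)
    · intro k n τ _
      rw [norm_iteratedFDeriv_eq_norm_iteratedDeriv]
      rw [iter_Dt k (F := fun p => Fs ε σ (n + 1) p - Fs ε σ n p) ((sF (n + 1)).sub (sF n)) 0,
        Dt_iter_sub k (sF _) (sF _)]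
      exact hb k n (τ, 0)
  · intro τ δ hδ
    have h1 : Summable fun n => (Fs ε σ (n + 1) (τ, 0) - Fs ε σ n (τ, 0)) :=
      Summable.of_norm_bounded (hsum 0) (fun n => hb 0 n (τ, 0))
    have h2 := h1.hasSum.tendsto_sum_nat
    simp only [Finset.sum_range_sub (fun n => Fs ε σ n (τ, 0))] at h2
    have h0 : Fs ε σ 0 (τ, 0) = 0 := rfl
    rw [h0] at h2
    simp only [sub_zero] at h2
    obtain ⟨_, C', q', hC', hq', hq1', hF⟩ := (hO 0).z
    have h3 : Tendsto (fun n => C' * q' ^ n) atTop (𝓝 (C' * 0)) :=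
      (tendsto_pow_atTop_nhds_zero_of_lt_one hq'.le hq1').const_mul _
    rw [mul_zero] at h3
    have h4 := (tendsto_add_atTop_iff_nat 1).2 h2
    have h5 := (tendsto_add_atTop_iff_nat 1).2 h3
    obtain ⟨N, h6, h7⟩ := ((Metric.tendsto_nhds.1 h4 (δ/2) (by positivity)).and
      (h5.eventually (gt_mem_nhds (show (0:ℝ) < δ / 2 by positivity)))).exists
    refine ⟨N, fun x => ?_⟩
    rw [← Fs_eq]
    rw [Real.dist_eq] at h6
    have h8 := hF (N + 1) τ x 0
    have := abs_sub_le (Fs ε σ (N + 1) (τ, x)) (Fs ε σ (N + 1) (τ, 0))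
      (∑' n, (Fs ε σ (n + 1) (τ, 0) - Fs ε σ n (τ, 0)))
    linarith

instance nuI_prob : IsProbabilityMeasure nuI := by
  constructor
  simp [nuI]
  norm_num

lemma IsProductNuZ.eq {P : Measure (ℤ → ℝ)} (hP : IsProductNuZ P) :
    P = Measure.infinitePi (fun _ : ℤ => nuI) := by
  have h1 := Measure.isProjectiveLimit_infinitePi (fun _ : ℤ => nuI)
  have h2 : IsProjectiveLimit P (fun s : Finset ℤ => Measure.pi (fun _ : s => nuI)) :=
    fun s => hP.2 s
  exact h2.unique h1

lemma IsProductNuZ.law {P : Measure (ℤ → ℝ)} (hP : IsProductNuZ P) (i : ℤ) :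
    P.map (fun ω => ω i) = nuI := by
  rw [hP.eq]; exact Measure.infinitePi_map_eval _ i

lemma IsProductNuZ.indep {P : Measure (ℤ → ℝ)} (hP : IsProductNuZ P) :
    ProbabilityTheory.iIndepFun (fun (i : ℤ) (ω : ℤ → ℝ) => ω i) P := by
  rw [hP.eq]
  exact ProbabilityTheory.iIndepFun_infinitePi (X := fun _ x => x) (fun _ => measurable_id)

lemma IsProductNuZ.ae_mem {P : Measure (ℤ → ℝ)} (hP : IsProductNuZ P) :
    ∀ᵐ ω ∂P, ∀ i : ℤ, ω i ∈ Icc (-(1/2) : ℝ) (1/2) := by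
  rw [ae_all_iff]
  intro i
  have h : ∀ᵐ w ∂nuI, w ∈ Icc (-(1/2) : ℝ) (1/2) := ae_restrict_mem measurableSet_Icc
  rw [← hP.law i] at h
  exact ae_of_ae_map (measurable_pi_apply i).aemeasurable h

lemma Gn_congr (τ ε σ : ℝ) (ω ω' : ℤ → ℝ) (n : ℕ) (h : ∀ k : ℕ, k < n → ω k = ω' k) :
    Gn τ ε σ ω n = Gn τ ε σ ω' n := by
  induction n with
  | zero => rfl
  | succ n ih =>
    rw [Gn, Gn, ih (fun k hk => h k (by lia)), h n (by lia)]

lemma Gn_meas (τ ε σ : ℝ) (n : ℕ) (x : ℝ) : Measurable fun ω => Gn τ ε σ ω n x := by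
  induction n with
  | zero => exact measurable_const
  | succ n ih =>
    have : (fun ω => Gn τ ε σ ω (n + 1) x) = fun ω =>
      Gn τ ε σ ω n x + τ + σ * ω n - ε * Real.sin (2 * π * Gn τ ε σ ω n x) := rfl
    rw [this]
    fun_prop

lemma Gn_succ (τ ε σ : ℝ) (ω : ℤ → ℝ) (n : ℕ) (x : ℝ) :
    Gn τ ε σ ω (n + 1) x = Tr τ ε (Gn τ ε σ ω n x) + σ * ω n := by
  have : Gn τ ε σ ω (n + 1) x =
      Gn τ ε σ ω n x + τ + σ * ω n - ε * Real.sin (2 * π * Gn τ ε σ ω n x) := rfl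
  rw [this, Tr]; ring

def psi (τ ε σ : ℝ) (g : ℝ → ℝ) (x w : ℝ) : ℝ :=
  σ * w + g (Tr τ ε x + σ * w) - Pop τ ε σ g x

def Ss (τ ε σ : ℝ) (g : ℝ → ℝ) (ω : ℤ → ℝ) (n : ℕ) : ℝ :=
  ∑ k ∈ Finset.range n, psi τ ε σ g (Gn τ ε σ ω k 0) (ω k)

lemma psi_meas (τ ε σ : ℝ) (g : ℝ → ℝ) (hg : Continuous g) :
    Measurable fun z : ℝ × ℝ => psi τ ε σ g z.1 z.2 := by
  have h1 := Pop_cont τ ε σ g hg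
  have h2 := Tr_cont τ ε
  unfold psi
  exact Continuous.measurable (by fun_prop)

lemma Ss_meas (τ ε σ : ℝ) (g : ℝ → ℝ) (hg : Continuous g) (n : ℕ) :
    Measurable fun ω => Ss τ ε σ g ω n := by
  unfold Ss
  refine Finset.measurable_fun_sum _ fun k _ => ?_
  exact (psi_meas τ ε σ g hg).comp ((Gn_meas τ ε σ k 0).prodMk (measurable_pi_apply _))

lemma Ss_congr (τ ε σ : ℝ) (g : ℝ → ℝ) (ω ω' : ℤ → ℝ) (n : ℕ) (h : ∀ k : ℕ, k < n → ω k = ω' k) :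
    Ss τ ε σ g ω n = Ss τ ε σ g ω' n := by
  refine Finset.sum_congr rfl fun k hk => ?_
  rw [Finset.mem_range] at hk
  rw [Gn_congr τ ε σ ω ω' k (fun j hj => h j (by lia)), h k hk]

lemma psi_int (τ ε σ : ℝ) (g : ℝ → ℝ) (hg : Continuous g) (x : ℝ) :
    ∫ w, psi τ ε σ g x w ∂nuI = 0 := by
  rw [nuI, integral_Icc_eq_integral_Ioc, ← intervalIntegral.integral_of_le (by norm_num)]
  unfold psi
  rw [intervalIntegral.integral_sub ((Continuous.intervalIntegrable (by fun_prop) _ _))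
    (by simp), intervalIntegral.integral_add (Continuous.intervalIntegrable (by fun_prop) _ _)
    (Pop_ii τ ε σ g hg x _ _)]
  have h0 : ∫ x in (-(1/2) : ℝ)..(1/2), σ * x = 0 := by
    rw [intervalIntegral.integral_const_mul, integral_id]; norm_num
  rw [h0]
  simp only [Pop, intervalIntegral.integral_const]
  norm_num

lemma Pop_bd (τ ε σ : ℝ) (g : ℝ → ℝ) (B : ℝ) (hB : ∀ x, |g x| ≤ B) (x : ℝ) :
    |Pop τ ε σ g x| ≤ B := by
  have := intervalIntegral.norm_integral_le_of_norm_le_const (a := (-(1/2):ℝ)) (b := 1/2) (C := B)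
    (f := fun w => g (Tr τ ε x + σ * w)) (fun w _ => hB _)
  norm_num at this
  norm_num [Pop]
  exact this

lemma psi_bd (τ ε σ : ℝ) (hσ : 0 < σ) (g : ℝ → ℝ) (B : ℝ) (hB : ∀ x, |g x| ≤ B) (x w : ℝ)
    (hw : w ∈ Icc (-(1/2) : ℝ) (1/2)) : |psi τ ε σ g x w| ≤ σ + 2 * B := by
  have h1 := abs_le.1 (hB (Tr τ ε x + σ * w))
  have h2 := abs_le.1 (Pop_bd τ ε σ g B hB x)
  unfold psi
  rw [abs_le]
  constructor <;> nlinarith [hw.1, hw.2]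

lemma indep_past {P : Measure (ℤ → ℝ)} (hP : IsProductNuZ P) (n : ℕ) (f : (ℤ → ℝ) → ℝ × ℝ)
    (hf : Measurable f) (hc : ∀ ω ω', (∀ k : ℕ, k < n → ω k = ω' k) → f ω = f ω') :
    ProbabilityTheory.IndepFun f (fun ω => ω (n : ℤ)) P := by
  classical
  set S : Finset ℤ := (Finset.range n).image (fun k : ℕ => (k : ℤ))
  have hd : Disjoint S {(n : ℤ)} := by
    rw [Finset.disjoint_singleton_right]
    simp [S]
  have h := hP.indep.indepFun_finset S {(n : ℤ)} hd (fun i => measurable_pi_apply i)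
  set ex : (S → ℝ) → (ℤ → ℝ) := fun v i => if hi : i ∈ S then v ⟨i, hi⟩ else 0
  have hex : Measurable ex := by
    rw [measurable_pi_iff]
    intro i
    by_cases hi : i ∈ S
    · simp only [ex, hi, dite_true]; exact measurable_pi_apply _
    · simp only [ex, hi, dite_false]; exact measurable_const
  have hev : Measurable (fun v : ({(n : ℤ)} : Finset ℤ) → ℝ => v ⟨n, by simp⟩) :=
    measurable_pi_apply _
  have h2 := h.comp (φ := fun v => f (ex v))
    (ψ := fun v : ({(n : ℤ)} : Finset ℤ) → ℝ => v ⟨n, by simp⟩) (hf.comp hex)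
    hev
  convert! h2 using 1
  ext1 ω
  refine hc _ _ fun k hk => ?_
  have : (k : ℤ) ∈ S := by
    simp only [S, Finset.mem_image, Finset.mem_range]; exact ⟨k, hk, rfl⟩
  simp only [ex, this, dite_true]

lemma cross {P : Measure (ℤ → ℝ)} (hP : IsProductNuZ P) (τ ε σ : ℝ) (g : ℝ → ℝ)
    (hg : Continuous g) (n : ℕ)
    (hi : Integrable (fun ω => Ss τ ε σ g ω n * psi τ ε σ g (Gn τ ε σ ω n 0) (ω n)) P) :
    ∫ ω, Ss τ ε σ g ω n * psi τ ε σ g (Gn τ ε σ ω n 0) (ω n) ∂P = 0 := by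
  have := hP.1
  have hm : Measurable fun ω => (Ss τ ε σ g ω n, Gn τ ε σ ω n 0) :=
    (Ss_meas τ ε σ g hg n).prodMk (Gn_meas τ ε σ n 0)
  have h1 := indep_past hP n (fun ω => (Ss τ ε σ g ω n, Gn τ ε σ ω n 0)) hm (fun ω ω' h => by
      rw [Ss_congr τ ε σ g ω ω' n h, Gn_congr τ ε σ ω ω' n h])
  rw [ProbabilityTheory.indepFun_iff_map_prod_eq_prod_map_map hm.aemeasurable
    (measurable_pi_apply _).aemeasurable, hP.law] at h1
  set Φ : (ℤ → ℝ) → (ℝ × ℝ) × ℝ := fun ω => ((Ss τ ε σ g ω n, Gn τ ε σ ω n 0), ω n)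
  have hΦ : Measurable Φ := hm.prodMk (measurable_pi_apply _)
  set k : (ℝ × ℝ) × ℝ → ℝ := fun z => z.1.1 * psi τ ε σ g z.1.2 z.2
  have hk : Measurable k := by
    have := (psi_meas τ ε σ g hg).comp (f := fun z : (ℝ × ℝ) × ℝ => (z.1.2, z.2)) (by fun_prop)
    exact (measurable_fst.fst).mul this
  have e : ∫ ω, Ss τ ε σ g ω n * psi τ ε σ g (Gn τ ε σ ω n 0) (ω n) ∂P = ∫ z, k z ∂(P.map Φ) :=
    (integral_map hΦ.aemeasurable hk.aestronglyMeasurable).symm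
  have hi2 : Integrable k (P.map Φ) :=
    (integrable_map_measure hk.aestronglyMeasurable hΦ.aemeasurable).2 hi
  have h2 : P.map Φ = (P.map fun ω => (Ss τ ε σ g ω n, Gn τ ε σ ω n 0)).prod nuI := h1
  have := Measure.isProbabilityMeasure_map (μ := P) hm.aemeasurable
  rw [h2] at hi2
  rw [e, h2]
  rw [integral_prod _ hi2]
  simp only [k, integral_const_mul, psi_int τ ε σ g hg, mul_zero, integral_zero]

lemma Ss_bd (τ ε σ : ℝ) (hσ : 0 < σ) (g : ℝ → ℝ) (B : ℝ) (hB : ∀ x, |g x| ≤ B) (ω : ℤ → ℝ)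
    (hω : ∀ i : ℤ, ω i ∈ Icc (-(1/2) : ℝ) (1/2)) (n : ℕ) :
    |Ss τ ε σ g ω n| ≤ n * (σ + 2 * B) := by
  unfold Ss
  refine (Finset.abs_sum_le_sum_abs _ _).trans ?_
  refine (Finset.sum_le_card_nsmul (Finset.range n) _ (σ + 2 * B) (fun k _ => psi_bd τ ε σ hσ g B hB (Gn τ ε σ ω k 0) (ω (k:ℤ)) (hω k))).trans ?_
  simp [mul_add]

lemma second_moment {P : Measure (ℤ → ℝ)} (hP : IsProductNuZ P) (τ ε σ : ℝ) (hσ : 0 < σ)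
    (g : ℝ → ℝ) (hg : Continuous g) (B : ℝ) (hB : ∀ x, |g x| ≤ B) (n : ℕ) :
    Integrable (fun ω => Ss τ ε σ g ω n ^ 2) P ∧
      ∫ ω, Ss τ ε σ g ω n ^ 2 ∂P ≤ n * (σ + 2 * B) ^ 2 := by
  have := hP.1
  have hB0 : 0 ≤ B := (abs_nonneg _).trans (hB 0)
  set M := σ + 2 * B
  have hM : 0 ≤ M := by positivity
  have mψ : ∀ n : ℕ, Measurable fun ω : ℤ → ℝ => psi τ ε σ g (Gn τ ε σ ω n 0) (ω n) := fun n =>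
    (psi_meas τ ε σ g hg).comp ((Gn_meas τ ε σ n 0).prodMk (measurable_pi_apply _))
  have i1 : ∀ n, Integrable (fun ω => Ss τ ε σ g ω n ^ 2) P := fun n => by
    refine Integrable.of_bound ((Ss_meas τ ε σ g hg n).pow_const 2).aestronglyMeasurable
      ((n * M) ^ 2) ?_
    filter_upwards [hP.ae_mem] with ω hω
    rw [norm_pow]
    exact pow_le_pow_left₀ (norm_nonneg _) (Ss_bd τ ε σ hσ g B hB ω hω n) 2
  have i2 : ∀ n : ℕ, Integrable (fun ω => Ss τ ε σ g ω n * psi τ ε σ g (Gn τ ε σ ω n 0) (ω n)) P := fun n => by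
    refine Integrable.of_bound ((Ss_meas τ ε σ g hg n).mul (mψ n)).aestronglyMeasurable
      ((n * M) * M) ?_
    filter_upwards [hP.ae_mem] with ω hω
    rw [norm_mul]
    exact mul_le_mul (Ss_bd τ ε σ hσ g B hB ω hω n) (psi_bd τ ε σ hσ g B hB _ _ (hω n))
      (norm_nonneg _) (by positivity)
  have hb : ∀ n : ℕ, ∀ᵐ ω ∂P, psi τ ε σ g (Gn τ ε σ ω n 0) (ω n) ^ 2 ≤ M ^ 2 := fun n => by
    filter_upwards [hP.ae_mem] with ω hω
    exact sq_le_sq' (abs_le.1 (psi_bd τ ε σ hσ g B hB _ _ (hω n))).1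
      (abs_le.1 (psi_bd τ ε σ hσ g B hB _ _ (hω n))).2
  have i3 : ∀ n : ℕ, Integrable (fun ω : ℤ → ℝ => psi τ ε σ g (Gn τ ε σ ω n 0) (ω n) ^ 2) P := fun n => by
    refine Integrable.of_bound ((mψ n).pow_const 2).aestronglyMeasurable (M ^ 2) ?_
    filter_upwards [hb n] with ω hω
    rw [norm_pow, Real.norm_eq_abs, sq_abs]
    exact hω
  refine ⟨i1 n, ?_⟩
  induction n with
  | zero => simp [Ss]
  | succ n ih =>
    have e : (fun ω => Ss τ ε σ g ω (n + 1) ^ 2) = fun ω => (Ss τ ε σ g ω n ^ 2 +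
        2 * (Ss τ ε σ g ω n * psi τ ε σ g (Gn τ ε σ ω n 0) (ω n))) +
        psi τ ε σ g (Gn τ ε σ ω n 0) (ω n) ^ 2 := by
      ext ω
      have : Ss τ ε σ g ω (n + 1) = Ss τ ε σ g ω n + psi τ ε σ g (Gn τ ε σ ω n 0) (ω n) :=
        Finset.sum_range_succ _ _
      rw [this]; ring
    have i4 : Integrable (fun ω => Ss τ ε σ g ω n ^ 2 +
        2 * (Ss τ ε σ g ω n * psi τ ε σ g (Gn τ ε σ ω n 0) (ω n))) P :=
      (i1 n).add ((i2 n).const_mul 2)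
    rw [e, integral_add i4 (i3 n),
      integral_add (i1 n) ((i2 n).const_mul 2), integral_const_mul, cross hP τ ε σ g hg n (i2 n)]
    have h3 : ∫ ω, psi τ ε σ g (Gn τ ε σ ω n 0) (ω n) ^ 2 ∂P ≤ M ^ 2 := by
      have := integral_mono_ae (i3 n) (integrable_const (M ^ 2)) (hb n)
      simpa using this
    push_cast
    linarith

lemma interp (S : ℕ → ℝ) (M : ℝ) (hM : 0 ≤ M) (h : ∀ n, |S (n + 1) - S n| ≤ M)
    (hs : Tendsto (fun k : ℕ => S (k ^ 2) / (k ^ 2 : ℝ)) atTop (𝓝 0)) :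
    Tendsto (fun n : ℕ => S n / n) atTop (𝓝 0) := by
  have hd : ∀ a j, |S (a + j) - S a| ≤ j * M := by
    intro a j
    induction j with
    | zero => simp
    | succ j ih =>
      have h1 := h (a + j)
      have h2 := abs_sub_le (S (a + j + 1)) (S (a + j)) (S a)
      rw [← add_assoc]
      push_cast
      linarith
  have hk : Tendsto Nat.sqrt atTop atTop := by
    refine tendsto_atTop.2 fun b => ?_
    filter_upwards [eventually_ge_atTop (b * b)] with n hn
    exact Nat.le_sqrt.2 hn
  have h1 := (hs.comp hk).abs
  have h2 : Tendsto (fun n : ℕ => 2 * M * ((Nat.sqrt n : ℝ))⁻¹) atTop (𝓝 (2 * M * 0)) :=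
    ((tendsto_inv_atTop_zero.comp (tendsto_natCast_atTop_atTop (R := ℝ))).comp hk).const_mul _
  have h3 := h1.add h2
  simp only [abs_zero, mul_zero, add_zero] at h3
  refine squeeze_zero_norm' ?_ h3
  filter_upwards [eventually_ge_atTop 1] with n hn
  simp only [comp_apply]
  obtain ⟨k, hkdef⟩ : ∃ k, k = Nat.sqrt n := ⟨_, rfl⟩
  rw [← hkdef]
  have k1 : 1 ≤ k := by rw [hkdef]; exact Nat.le_sqrt.2 (by simpa using hn)
  have k2 : k ^ 2 ≤ n := by rw [pow_two, hkdef]; exact Nat.sqrt_le n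
  have k3 : n ≤ k * k + k + k := by rw [hkdef]; exact Nat.sqrt_le_add n
  clear hkdef
  obtain ⟨j, rfl⟩ := Nat.exists_eq_add_of_le k2
  have hj : j ≤ 2 * k := by nlinarith
  have h4 := hd (k ^ 2) j
  have kp : (0:ℝ) < k := by exact_mod_cast k1
  have h5 : |S (k ^ 2 + j)| ≤ |S (k ^ 2)| + 2 * k * M := by
    have := abs_sub_abs_le_abs_sub (S (k ^ 2 + j)) (S (k ^ 2))
    have hj' : (j:ℝ) ≤ 2 * k := by exact_mod_cast hj
    nlinarith
  rw [norm_div, Real.norm_eq_abs, Real.norm_natCast, abs_div, abs_of_pos (by positivity : (0:ℝ) < (k:ℝ) ^ 2)]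
  calc |S (k ^ 2 + j)| / ((k ^ 2 + j : ℕ) : ℝ) ≤ (|S (k ^ 2)| + 2 * k * M) / (k:ℝ) ^ 2 := by
        gcongr
        push_cast; linarith [(Nat.cast_nonneg j : (0:ℝ) ≤ j)]
    _ = _ := by field_simp

lemma slln {P : Measure (ℤ → ℝ)} (hP : IsProductNuZ P) (τ ε σ : ℝ) (hσ : 0 < σ)
    (g : ℝ → ℝ) (hg : Continuous g) (B : ℝ) (hB : ∀ x, |g x| ≤ B) :
    ∀ᵐ ω ∂P, Tendsto (fun n : ℕ => Ss τ ε σ g ω n / n) atTop (𝓝 0) := by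
  have := hP.1
  have hB0 : 0 ≤ B := (abs_nonneg _).trans (hB 0)
  set M := σ + 2 * B with hMdef
  have hM : 0 ≤ M := by positivity
  set f : ℕ → (ℤ → ℝ) → ENNReal := fun k ω =>
    ENNReal.ofReal ((Ss τ ε σ g ω ((k + 1) ^ 2) / ((k + 1 : ℕ) ^ 2 : ℝ)) ^ 2)
  have hf : ∀ k, Measurable (f k) := fun k =>
    (((Ss_meas τ ε σ g hg _).div_const _).pow_const 2).ennreal_ofReal
  have hI : ∀ k, ∫⁻ ω, f k ω ∂P ≤ ENNReal.ofReal (M ^ 2 * (1 / ((k + 1 : ℕ) : ℝ) ^ 2)) := by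
    intro k
    obtain ⟨h1, h2⟩ := second_moment hP τ ε σ hσ g hg B hB ((k + 1) ^ 2)
    have e : ∀ ω, (Ss τ ε σ g ω ((k + 1) ^ 2) / ((k + 1 : ℕ) ^ 2 : ℝ)) ^ 2 =
        Ss τ ε σ g ω ((k + 1) ^ 2) ^ 2 / (((k + 1 : ℕ) ^ 2 : ℝ)) ^ 2 := fun ω => div_pow _ _ _
    simp only [f, e]
    rw [← ofReal_integral_eq_lintegral_ofReal (h1.div_const _)
      (Eventually.of_forall fun ω => by positivity)]
    apply ENNReal.ofReal_le_ofReal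
    rw [integral_div, div_le_iff₀ (by positivity)]
    refine h2.trans (le_of_eq ?_)
    push_cast
    field_simp
    simp [M]
  have hS : ∑' k, ∫⁻ ω, f k ω ∂P ≠ ⊤ := by
    refine ne_top_of_le_ne_top ?_ (ENNReal.tsum_le_tsum hI)
    have hs : Summable fun k : ℕ => M ^ 2 * (1 / ((k + 1 : ℕ) : ℝ) ^ 2) :=
      (((summable_nat_add_iff 1).2 (Real.summable_one_div_nat_pow.2 (by norm_num : 1 < 2)))).mul_left _
    rw [← ENNReal.ofReal_tsum_of_nonneg (fun k => by positivity) hs]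
    exact ENNReal.ofReal_ne_top
  rw [← lintegral_tsum (fun k => (hf k).aemeasurable)] at hS
  have hae := ae_lt_top (Measurable.tsum hf) hS
  filter_upwards [hae, hP.ae_mem] with ω h1 hω
  refine interp _ M hM (fun n => ?_) ?_
  · have : Ss τ ε σ g ω (n + 1) = Ss τ ε σ g ω n + psi τ ε σ g (Gn τ ε σ ω n 0) (ω n) :=
      Finset.sum_range_succ _ _
    rw [this, add_sub_cancel_left]
    exact psi_bd τ ε σ hσ g B hB _ _ (hω n)
  · have h2 := ENNReal.tendsto_atTop_zero_of_tsum_ne_top h1.ne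
    have h3 := (ENNReal.tendsto_toReal ENNReal.zero_ne_top).comp h2
    have h4 : Tendsto (fun k : ℕ => (Ss τ ε σ g ω ((k + 1) ^ 2) / ((k + 1 : ℕ) ^ 2 : ℝ)) ^ 2)
        atTop (𝓝 0) := by
      refine h3.congr fun k => ?_
      simp only [f, comp_apply]
      exact ENNReal.toReal_ofReal (by positivity)
    have h5 := h4.sqrt
    simp only [Real.sqrt_sq_eq_abs, Real.sqrt_zero] at h5
    have h6 := (tendsto_zero_iff_abs_tendsto_zero _).2 h5
    exact (tendsto_add_atTop_iff_nat 1).1 h6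

lemma phi_iter_bd (τ ε σ : ℝ) (hε : 0 < ε) (N : ℕ) (x : ℝ) :
    |(Qop τ ε σ)^[N] (fun x => -ε * Real.sin (2 * π * x)) x| ≤ ε := by
  induction N generalizing x with
  | zero =>
    simp only [iterate_zero, id, abs_mul, abs_neg, abs_of_pos hε]
    exact mul_le_of_le_one_right hε.le (Real.abs_sin_le_one _)
  | succ N ih =>
    rw [iterate_succ_apply']
    have h1 := abs_le.1 (ih x)
    have h2 := abs_le.1 (Pop_bd τ ε σ _ ε ih x)
    simp only [Qop]
    rw [abs_le]
    constructor <;> linarith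

lemma poisson (τ ε σ : ℝ) (hε : 0 < ε) (N : ℕ) : ∃ (g : ℝ → ℝ) (B : ℝ), Continuous g ∧
    (∀ x, |g x| ≤ B) ∧ ∀ x, g x - Pop τ ε σ g x = -ε * Real.sin (2 * π * x) -
      (Qop τ ε σ)^[N] (fun x => -ε * Real.sin (2 * π * x)) x := by
  induction N with
  | zero => exact ⟨fun _ => 0, 0, continuous_const, by simp, by simp [Pop]⟩
  | succ N ih =>
    obtain ⟨g, B, hg, hB, h⟩ := ih
    set u := (Qop τ ε σ)^[N] (fun x => -ε * Real.sin (2 * π * x))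
    have hu : Continuous u := Qop_iter_cont _ _ _ _ _ (by fun_prop)
    refine ⟨fun x => 1 * g x + (1/2) * u x, B + ε, by fun_prop, fun x => ?_, fun x => ?_⟩
    · have h1 := abs_le.1 (hB x)
      have h2 := abs_le.1 (phi_iter_bd τ ε σ hε N x)
      rw [abs_le]
      constructor <;> linarith
    · rw [Pop_lin τ ε σ 1 (1/2) g u hg hu x, iterate_succ_apply']
      have := h x
      simp only [Qop]
      linarith

lemma Gn_decomp (τ ε σ : ℝ) (g u : ℝ → ℝ)
    (hgu : ∀ x, g x - Pop τ ε σ g x = -ε * Real.sin (2 * π * x) - u x) (ω : ℤ → ℝ) (n : ℕ) :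
    Gn τ ε σ ω n 0 = n * τ + ∑ k ∈ Finset.range n, u (Gn τ ε σ ω k 0) + Ss τ ε σ g ω n
      - g (Gn τ ε σ ω n 0) + g 0 := by
  induction n with
  | zero => simp [Gn, Ss]
  | succ n ih =>
    have e : Ss τ ε σ g ω (n + 1) = Ss τ ε σ g ω n + psi τ ε σ g (Gn τ ε σ ω n 0) (ω n) :=
        Finset.sum_range_succ _ _
    rw [e, Finset.sum_range_succ, psi, ← Gn_succ]
    have h1 := hgu (Gn τ ε σ ω n 0)
    have h2 := Gn_succ τ ε σ ω n 0
    simp only [Tr] at h2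
    push_cast
    linarith

lemma Gn_mono (τ ε σ : ℝ) (hε : 0 < ε) (hεπ : 2 * π * ε < 1) (ω : ℤ → ℝ) (n : ℕ) :
    Monotone (Gn τ ε σ ω n) := by
  induction n with
  | zero => exact monotone_id
  | succ n ih =>
    intro x y h
    rw [Gn_succ, Gn_succ]
    have := Tr_mono τ ε hε hεπ (ih h)
    linarith

lemma Gn_add_int (τ ε σ : ℝ) (ω : ℤ → ℝ) (n : ℕ) (x : ℝ) (m : ℤ) :
    Gn τ ε σ ω n (x + m) = Gn τ ε σ ω n x + m := by
  induction n with
  | zero => rfl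
  | succ n ih =>
    rw [Gn_succ, Gn_succ, ih, Tr_add_int]; ring

lemma Gn_all (τ ε σ : ℝ) (hε : 0 < ε) (hεπ : 2 * π * ε < 1) (ω : ℤ → ℝ) (r : ℝ)
    (h : Tendsto (fun n : ℕ => Gn τ ε σ ω n 0 / n) atTop (𝓝 r)) (x : ℝ) :
    Tendsto (fun n : ℕ => (Gn τ ε σ ω n x - x) / n) atTop (𝓝 r) := by
  have h1 : Tendsto (fun n : ℕ => (Gn τ ε σ ω n x - x - Gn τ ε σ ω n 0) / n) atTop (𝓝 0) := by
    refine squeeze_zero_norm' (a := fun n : ℕ => 1 / (n : ℝ)) ?_ tendsto_one_div_atTop_nhds_zero_nat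
    refine Eventually.of_forall fun n => ?_
    rw [norm_div, Real.norm_natCast]
    refine div_le_div_of_nonneg_right ?_ (Nat.cast_nonneg n)
    have a1 := Gn_mono τ ε σ hε hεπ ω n (Int.floor_le x)
    have a2 := Gn_mono τ ε σ hε hεπ ω n (Int.lt_floor_add_one x).le
    have b1 := Gn_add_int τ ε σ ω n 0 ⌊x⌋
    have b2 := Gn_add_int τ ε σ ω n 0 (⌊x⌋ + 1)
    push_cast at b2
    rw [zero_add] at b1 b2
    rw [b1] at a1
    rw [b2] at a2
    have c1 := Int.floor_le x
    have c2 := Int.lt_floor_add_one x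
    rw [Real.norm_eq_abs, abs_le]
    constructor <;> linarith
  have h2 := h.add h1
  rw [add_zero] at h2
  refine h2.congr fun n => ?_
  rw [← add_div]; congr 1; ring

lemma approx {P : Measure (ℤ → ℝ)} (hP : IsProductNuZ P) (τ ε σ : ℝ) (hε : 0 < ε) (hσ : 0 < σ)
    (c δ : ℝ) (hδ : 0 < δ) (N : ℕ)
    (hN : ∀ x, |(Qop τ ε σ)^[N] (fun x => -ε * Real.sin (2 * π * x)) x - c| ≤ δ) :
    ∀ᵐ ω ∂P, ∀ᶠ n : ℕ in atTop, |Gn τ ε σ ω n 0 / n - (τ + c)| ≤ 3 * δ := by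
  obtain ⟨g, B, hg, hB, hgu⟩ := poisson τ ε σ hε N
  filter_upwards [slln hP τ ε σ hσ g hg B hB] with ω hω
  have h1 : Tendsto (fun n : ℕ => 2 * B * (1 / (n : ℝ))) atTop (𝓝 (2 * B * 0)) :=
    tendsto_one_div_atTop_nhds_zero_nat.const_mul _
  rw [mul_zero] at h1
  filter_upwards [Metric.tendsto_nhds.1 hω δ hδ, h1.eventually (gt_mem_nhds hδ),
    eventually_ge_atTop 1] with n a1 a2 a3
  have np : (0:ℝ) < n := by exact_mod_cast a3
  rw [Real.dist_eq, sub_zero, abs_div, Nat.abs_cast, div_lt_iff₀ np] at a1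
  rw [← mul_div_assoc, mul_one, div_lt_iff₀ np] at a2
  have hd := Gn_decomp τ ε σ g _ hgu ω n
  have hs : |∑ k ∈ Finset.range n,
      ((Qop τ ε σ)^[N] (fun x => -ε * Real.sin (2 * π * x)) (Gn τ ε σ ω k 0) - c)| ≤ n * δ := by
    refine (Finset.abs_sum_le_sum_abs _ _).trans ?_
    refine (Finset.sum_le_card_nsmul (Finset.range n) _ δ fun k _ => hN _).trans ?_
    simp
  rw [Finset.sum_sub_distrib] at hs
  simp only [Finset.sum_const, Finset.card_range, nsmul_eq_mul] at hs
  have e : Gn τ ε σ ω n 0 / n - (τ + c) = (Gn τ ε σ ω n 0 - n * (τ + c)) / n := by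
    field_simp
  rw [e, abs_div, Nat.abs_cast, div_le_iff₀ np]
  have b1 := abs_le.1 (hB (Gn τ ε σ ω n 0))
  have b2 := abs_le.1 (hB 0)
  have b3 := abs_le.1 hs
  have b4 := abs_lt.1 a1
  rw [abs_le]
  constructor <;> linarith

lemma final_thm (ε σ : ℝ)
    (hε : 0 < ε) (hεπ : 2 * π * ε < 1) (hσ : 0 < σ)
    (P : Measure (ℤ → ℝ)) (hP : IsProductNuZ P) :
    ∃ r : ℝ → ℝ, ContDiff ℝ (⊤ : ℕ∞) r ∧
      ∀ τ : ℝ, ∀ᵐ ω ∂P, ∀ x : ℝ,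
        Tendsto (fun n : ℕ => (Gn τ ε σ ω n x - x) / n) atTop (nhds (r τ)) := by
  obtain ⟨c, hc, H⟩ := corr ε σ hε hεπ hσ
  refine ⟨fun τ => τ + c τ, contDiff_id.add hc, fun τ => ?_⟩
  have h1 : ∀ j : ℕ, ∀ᵐ ω ∂P, ∀ᶠ n : ℕ in atTop,
      |Gn τ ε σ ω n 0 / n - (τ + c τ)| ≤ 3 * (1 / ((j : ℝ) + 1)) := by
    intro j
    obtain ⟨N, hN⟩ := H τ (1 / ((j : ℝ) + 1)) (by positivity)
    exact approx hP τ ε σ hε hσ (c τ) _ (by positivity) N hN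
  rw [← ae_all_iff] at h1
  filter_upwards [h1] with ω hω
  refine Gn_all τ ε σ hε hεπ ω _ ?_
  rw [Metric.tendsto_nhds]
  intro δ hδ
  obtain ⟨j, hj⟩ := exists_nat_one_div_lt (show 0 < δ / 3 by positivity)
  filter_upwards [hω j] with n hn
  rw [Real.dist_eq]
  linarith

/-- **Smooth dependence of the random rotation number on `τ`:** for fixed `ε` (with
`0 < 2πε < 1`) and fixed `σ > 0`, there is a `C^∞` function `r : ℝ → ℝ` such that for
every `τ`, for `P`-a.e. `ω` and every `x`, `(G^n_{τ,ω}(x) − x)/n → r(τ)`. -/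
theorem noisy_circle_map_rotation_number_smooth (ε σ : ℝ)
    (hε : 0 < ε) (hεπ : 2 * π * ε < 1) (hσ : 0 < σ)
    (P : Measure (ℤ → ℝ)) (hP : IsProductNuZ P) :
    ∃ r : ℝ → ℝ, ContDiff ℝ (⊤ : ℕ∞) r ∧
      ∀ τ : ℝ, ∀ᵐ ω ∂P, ∀ x : ℝ,
        Tendsto (fun n : ℕ => (Gn τ ε σ ω n x - x) / n) atTop (nhds (r τ)) := by
  exact final_thm ε σ hε hεπ hσ P hP
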